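/- Let l be a prime with l ∉ {2,3,7}. If f is a monic irreducible factor of Ĥ_{7,l}(x) in 𝔽_l[x] of degree 3 or 6, then the set of roots of f in an algebraic closure of 𝔽_l is invariant under the map φ(d) = −1/(d−1) (in particular no root of Ĥ_{7,l} equals 1, so φ is defined on the roots). Moreover, every monic irreducible cubic factor of Ĥ_{7,l}(x) over 𝔽_l has the form g_a(x) = x³ + ax² − (a+3)x + 1 for some a ∈ 𝔽_l, and every monic irreducible sextic factor f of Ĥ_{7,l}(x) over 𝔽_l factors over the quadratic extension 𝔽_{l²} as f(x) = g_a(x)·g_{a^l}(x) for some a ∈ 𝔽_{l²}, where g_a(x) = x³ + ax² − (a+3)x + 1. -/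

import Mathlib

open Polynomial

/-- The Hasse invariant `Ĥ_{7,l}(x)` of the Tate normal form `E₇` for a point of
order 7, as a polynomial over `𝔽_l = ZMod l`.  Here `n_l = ⌊l/12⌋`,
`r = 1` iff `l ≡ 2 (mod 3)`, `s = 1` iff `l ≡ 3 (mod 4)`. -/
noncomputable def H7 (l : ℕ) : Polynomial (ZMod l) :=
  (X ^ 2 - X + 1) ^ (if l % 3 = 2 then 1 else 0) *
  (X ^ 6 - 11 * X ^ 5 + 30 * X ^ 4 - 15 * X ^ 3 - 10 * X ^ 2 + 5 * X + 1) ^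
    (if l % 3 = 2 then 1 else 0) *
  (X ^ 12 - 18 * X ^ 11 + 117 * X ^ 10 - 354 * X ^ 9 + 570 * X ^ 8 - 486 * X ^ 7 +
      273 * X ^ 6 - 222 * X ^ 5 + 174 * X ^ 4 - 46 * X ^ 3 - 15 * X ^ 2 + 6 * X + 1) ^
    (if l % 4 = 3 then 1 else 0) *
  ∑ k ∈ Finset.range (l / 12 + 1),
    (Nat.choose (2 * (l / 12) + (if l % 4 = 3 then 1 else 0))
        (2 * k + (if l % 4 = 3 then 1 else 0)) : Polynomial (ZMod l)) *
    (Nat.choose (2 * (l / 12) - 2 * k) (l / 12 - k) : Polynomial (ZMod l)) *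
    (-432) ^ (l / 12 - k) *
    ((X ^ 2 - X + 1) ^ 3 *
        (X ^ 6 - 11 * X ^ 5 + 30 * X ^ 4 - 15 * X ^ 3 - 10 * X ^ 2 + 5 * X + 1) ^ 3 -
      1728 * (X ^ 7 * (X - 1) ^ 7 * (X ^ 3 - 8 * X ^ 2 + 5 * X + 1))) ^ k *
    (X ^ 7 * (X - 1) ^ 7 * (X ^ 3 - 8 * X ^ 2 + 5 * X + 1)) ^ (l / 12 - k)

/-- The curve `y² = x³ + a x² + b x + c`. -/
def cubicCurve {F : Type*} [Field F] (a b c : F) : WeierstrassCurve.Affine F := ⟨0, a, 0, b, c⟩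

namespace cubicCurve

open WeierstrassCurve.Affine

variable {F : Type*} [Field F] {a b c : F}

lemma nonsingular_iff {x y : F} : (cubicCurve a b c).Nonsingular x y ↔
    y ^ 2 = x ^ 3 + a * x ^ 2 + b * x + c ∧ (3 * x ^ 2 + 2 * a * x + b ≠ 0 ∨ 2 * y ≠ 0) := by
  rw [WeierstrassCurve.Affine.nonsingular_iff, WeierstrassCurve.Affine.equation_iff]
  simp only [cubicCurve, zero_mul, add_zero, sub_zero]
  grind

lemma equation_of_nonsingular {x y : F} (h : (cubicCurve a b c).Nonsingular x y) :
    y ^ 2 = x ^ 3 + a * x ^ 2 + b * x + c :=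
  (nonsingular_iff.mp h).1

lemma neg_some {x y : F} (h : (cubicCurve a b c).Nonsingular x y) :
    ∃ h', -Point.some x y h = Point.some x (-y) h' := by
  have key := Point.neg_some h
  have hY : (cubicCurve a b c).negY x y = -y := by simp [negY, cubicCurve]
  simp only [hY] at key
  exact ⟨_, key⟩

section

variable [DecidableEq F]

lemma add_of_slope {x₁ x₂ y₁ y₂ s : F} (h₁ : (cubicCurve a b c).Nonsingular x₁ y₁)
    (h₂ : (cubicCurve a b c).Nonsingular x₂ y₂)
    (hs : x₁ ≠ x₂ ∧ s * (x₁ - x₂) = y₁ - y₂ ∨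
      x₁ = x₂ ∧ y₁ = y₂ ∧ 2 * y₁ ≠ 0 ∧ s * (2 * y₁) = 3 * x₁ ^ 2 + 2 * a * x₁ + b) :
    ∃ h, Point.some x₁ y₁ h₁ + Point.some x₂ y₂ h₂ =
      Point.some (s ^ 2 - a - x₁ - x₂) (-(y₁ + s * (s ^ 2 - a - x₁ - x₂ - x₁))) h := by
  have hn : ¬(x₁ = x₂ ∧ y₁ = (cubicCurve a b c).negY x₂ y₂) := by
    simp only [negY, cubicCurve]
    grind
  have hslope : (cubicCurve a b c).slope x₁ x₂ y₁ y₂ = s := by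
    rcases hs with ⟨hx, hs⟩ | ⟨hx, hy, h0, hs⟩
    · rw [slope_of_X_ne hx, div_eq_iff (sub_ne_zero.mpr hx), hs]
    · have hy' : y₁ ≠ (cubicCurve a b c).negY x₂ y₂ := fun h => hn ⟨hx, h⟩
      rw [slope_of_Y_ne hx hy', div_eq_iff (by simp only [negY, cubicCurve]; grind)]
      simp only [negY, cubicCurve]
      grind
  have hX : (cubicCurve a b c).addX x₁ x₂ s = s ^ 2 - a - x₁ - x₂ := by
    simp [addX, cubicCurve]
  have hY : (cubicCurve a b c).addY x₁ x₂ y₁ s =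
      -(y₁ + s * (s ^ 2 - a - x₁ - x₂ - x₁)) := by
    rw [addY, negAddY, negY, hX]
    simp only [cubicCurve]
    ring
  have key := Point.add_some hn (h₁ := h₁) (h₂ := h₂)
  have hns := nonsingular_add h₁ h₂ hn
  simp only [hslope, hX, hY] at key hns
  exact ⟨hns, key⟩

lemma add_eq_zero_of {x y₁ y₂ : F} (h₁ : (cubicCurve a b c).Nonsingular x y₁)
    (h₂ : (cubicCurve a b c).Nonsingular x y₂) (hy : y₁ = -y₂) :
    Point.some x y₁ h₁ + Point.some x y₂ h₂ = 0 :=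
  Point.add_of_Y_eq rfl (by simp [negY, cubicCurve, hy])

end

/-- `(N : D)` represents the `x`-coordinate of `P` in the projective line. -/
def XRep (P : (cubicCurve a b c).Point) (N D : F) : Prop :=
  match P with
  | .zero => D = 0 ∧ N ≠ 0
  | .some x _ _ => D ≠ 0 ∧ N = x * D

lemma xRep_zero {N D : F} : XRep (0 : (cubicCurve a b c).Point) N D ↔ D = 0 ∧ N ≠ 0 := Iff.rfl

lemma xRep_some {x y : F} {h : (cubicCurve a b c).Nonsingular x y} {N D : F} :
    XRep (Point.some x y h) N D ↔ D ≠ 0 ∧ N = x * D := Iff.rfl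

lemma XRep.ne_zero {P : (cubicCurve a b c).Point} {N D : F} (h : XRep P N D) :
    N ≠ 0 ∨ D ≠ 0 := by
  rcases P with _ | _
  · exact .inl h.2
  · exact .inr h.1

lemma XRep.unique {P : (cubicCurve a b c).Point} {N D N' D' : F} (h : XRep P N D)
    (h' : XRep P N' D') : ∃ k ≠ 0, N' = k * N ∧ D' = k * D := by
  rcases P with _ | ⟨x, y, hxy⟩
  · obtain ⟨h1, h2⟩ := h
    obtain ⟨h3, h4⟩ := h'
    exact ⟨N' / N, by positivity, by field_simp, by simp [h1, h3]⟩
  · obtain ⟨h1, h2⟩ := h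
    obtain ⟨h3, h4⟩ := h'
    exact ⟨D' / D, by positivity, by rw [h2, h4]; field_simp, by field_simp⟩

lemma XRep.smul {P : (cubicCurve a b c).Point} {N D k : F} (h : XRep P N D) (hk : k ≠ 0) :
    XRep P (k * N) (k * D) := by
  rcases P with _ | ⟨x, y, hxy⟩
  · exact ⟨by simp [h.1], mul_ne_zero hk h.2⟩
  · exact ⟨mul_ne_zero hk h.1, by rw [h.2]; ring⟩

lemma XRep.ratio {x y : F} {h : (cubicCurve a b c).Nonsingular x y} {N D : F}
    (hr : XRep (Point.some x y h) N D) : x = N / D := by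
  rw [eq_div_iff hr.1, hr.2]

/-- The leading form of the addition law on `x`-coordinates. -/
def formA {R : Type*} [CommRing R] (a b c x N D : R) : R :=
  (N * x) ^ 2 - 2 * b * (N * x) * D - 4 * c * (N + D * x) * D - (4 * a * c - b ^ 2) * D ^ 2

/-- The middle form of the addition law on `x`-coordinates. -/
def formB {R : Type*} [CommRing R] (a b c x N D : R) : R :=
  2 * (N + D * x) * (N * x) + 4 * a * (N * x) * D + 2 * b * (N + D * x) * D + 4 * c * D ^ 2

/-- The trailing form of the addition law on `x`-coordinates. -/
def formC {R : Type*} [CommRing R] (x N D : R) : R := (N - D * x) ^ 2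

variable [DecidableEq F]

lemma exists_xRep_add_sub (h2 : (2 : F) ≠ 0) {P : (cubicCurve a b c).Point} {x y : F}
    (hQ : (cubicCurve a b c).Nonsingular x y) {N D : F} (hP : XRep P N D) :
    ∃ N₁ D₁ N₂ D₂, XRep (P + .some x y hQ) N₁ D₁ ∧ XRep (P - .some x y hQ) N₂ D₂ ∧
      N₁ * N₂ = formA a b c x N D ∧ N₁ * D₂ + N₂ * D₁ = formB a b c x N D ∧
      D₁ * D₂ = formC x N D := by
  obtain ⟨hQ', hneg⟩ := neg_some hQ
  have eQ := equation_of_nonsingular hQ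
  rw [sub_eq_add_neg, hneg]
  rcases P with _ | ⟨x', y', hP'⟩
  · obtain ⟨hD, hN⟩ := hP
    refine ⟨N * x, N, N * x, N, ?_, ?_, ?_, ?_, ?_⟩
    · rw [← Point.zero_def, zero_add, xRep_some]; exact ⟨hN, by ring⟩
    · rw [← Point.zero_def, zero_add, xRep_some]; exact ⟨hN, by ring⟩
    all_goals subst hD; simp only [formA, formB, formC]; ring
  · obtain ⟨hD, hN⟩ := hP
    have eP := equation_of_nonsingular hP'
    by_cases hx : x' = x
    · subst hx
      by_cases hy : y' = 0
      · have hy0 : y = 0 := by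
          rw [← eP, hy] at eQ; simpa using eQ
        rw [add_eq_zero_of hP' hQ (by simp [hy, hy0]), add_eq_zero_of hP' hQ' (by simp [hy, hy0])]
        subst hy hy0
        have hns : 3 * x' ^ 2 + 2 * a * x' + b ≠ 0 := by
          rcases (nonsingular_iff.mp hQ).2 with h | h
          · exact h
          · simp at h
        refine ⟨D * (3 * x' ^ 2 + 2 * a * x' + b), 0, D * (3 * x' ^ 2 + 2 * a * x' + b), 0,
          ⟨rfl, mul_ne_zero hD hns⟩, ⟨rfl, mul_ne_zero hD hns⟩, ?_, ?_, ?_⟩ <;>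
        simp only [formA, formB, formC, hN] <;>
        grind
      · have hsq : (y - y') * (y + y') = 0 := by
          linear_combination eQ - eP
        have h2y : 2 * y' ≠ 0 := mul_ne_zero h2 hy
        have hslope : (3 * x' ^ 2 + 2 * a * x' + b) / (2 * y') * (2 * y') =
            3 * x' ^ 2 + 2 * a * x' + b := div_mul_cancel₀ _ h2y
        set s := (3 * x' ^ 2 + 2 * a * x' + b) / (2 * y')
        rcases mul_eq_zero.mp hsq with h | h
        · obtain rfl : y = y' := by linear_combination h
          obtain ⟨h3, e3⟩ := add_of_slope hP' hQ (s := s) (.inr ⟨rfl, rfl, h2y, hslope⟩)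
          rw [e3, add_eq_zero_of hP' hQ' (by simp)]
          refine ⟨D * (2 * y) ^ 2 * (s ^ 2 - a - x' - x'), D * (2 * y) ^ 2, D, 0,
            ⟨by positivity, by ring⟩, ⟨rfl, hD⟩, ?_, ?_, ?_⟩ <;>
          simp only [formA, formB, formC, hN]
          · linear_combination D ^ 2 * (s * (2 * y) + 3 * x' ^ 2 + 2 * a * x' + b) * hslope
              - 4 * D ^ 2 * (a + 2 * x') * eQ
          · linear_combination 4 * D ^ 2 * eQ
          · ring
        · obtain rfl : y = -y' := by linear_combination h
          obtain ⟨h3, e3⟩ := add_of_slope hP' hQ' (s := s) (.inr ⟨rfl, by simp, h2y, hslope⟩)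
          rw [e3, add_eq_zero_of hP' hQ (by simp)]
          refine ⟨D, 0, D * (2 * y') ^ 2 * (s ^ 2 - a - x' - x'), D * (2 * y') ^ 2,
             ⟨rfl, hD⟩, ⟨by positivity, by ring⟩, ?_, ?_, ?_⟩ <;>
          simp only [formA, formB, formC, hN]
          · linear_combination D ^ 2 * (s * (2 * y') + 3 * x' ^ 2 + 2 * a * x' + b) * hslope
              - 4 * D ^ 2 * (a + 2 * x') * eQ
          · linear_combination 4 * D ^ 2 * eQ
          · ring
    · have hx' : x' - x ≠ 0 := sub_ne_zero.mpr hx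
      obtain ⟨h3, e3⟩ := add_of_slope hP' hQ (s := (y' - y) / (x' - x))
        (.inl ⟨hx, div_mul_cancel₀ _ hx'⟩)
      obtain ⟨h4, e4⟩ := add_of_slope hP' hQ' (s := (y' - -y) / (x' - x))
        (.inl ⟨hx, div_mul_cancel₀ _ hx'⟩)
      rw [e3, e4]
      refine ⟨D * (x' - x) * (((y' - y) / (x' - x)) ^ 2 - a - x' - x), D * (x' - x),
        D * (x' - x) * (((y' - -y) / (x' - x)) ^ 2 - a - x' - x), D * (x' - x),
        ⟨by positivity, by ring⟩, ⟨by positivity, by ring⟩, ?_, ?_, ?_⟩ <;>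
      simp only [formA, formB, formC, hN]
      · have e1 : (((y' - y) / (x' - x)) ^ 2 - a - x' - x) * (x' - x) ^ 2 =
            (y' - y) ^ 2 - (a + x' + x) * (x' - x) ^ 2 := by field_simp; ring
        have e2 : (((y' - -y) / (x' - x)) ^ 2 - a - x' - x) * (x' - x) ^ 2 =
            (y' + y) ^ 2 - (a + x' + x) * (x' - x) ^ 2 := by field_simp; ring
        refine mul_right_cancel₀ (pow_ne_zero 2 hx') ?_
        rw [show ∀ u v w : F, D * w * u * (D * w * v) * w ^ 2 =
          D ^ 2 * (u * w ^ 2) * (v * w ^ 2) by intros; ring, e1, e2]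
        linear_combination D ^ 2 * (y' ^ 2 - y ^ 2 + (x' ^ 3 + a * x' ^ 2 + b * x' + c)
          - (x ^ 3 + a * x ^ 2 + b * x + c)) * (eP - eQ)
          - 2 * D ^ 2 * (a + x + x') * (x' - x) ^ 2 * (eP + eQ)
      · have e1 : (((y' - y) / (x' - x)) ^ 2 - a - x' - x) * (x' - x) ^ 2 =
            (y' - y) ^ 2 - (a + x' + x) * (x' - x) ^ 2 := by field_simp; ring
        have e2 : (((y' - -y) / (x' - x)) ^ 2 - a - x' - x) * (x' - x) ^ 2 =
            (y' + y) ^ 2 - (a + x' + x) * (x' - x) ^ 2 := by field_simp; ring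
        linear_combination D ^ 2 * (e1 + e2) + 2 * D ^ 2 * (eP + eQ)
      · ring

end cubicCurve

namespace cubicCurve

open WeierstrassCurve.Affine

lemma XRep.add {F : Type*} [Field F] {a b c : F} [DecidableEq F] (h2 : (2 : F) ≠ 0)
    {P : (cubicCurve a b c).Point} {x y : F}
    (hQ : (cubicCurve a b c).Nonsingular x y) {M E N₀ D₀ N₁ D₁ : F} (hP : XRep P M E)
    (h₀ : XRep (P - .some x y hQ) N₀ D₀) (hA : N₀ * N₁ = formA a b c x M E)
    (hB : N₁ * D₀ + N₀ * D₁ = formB a b c x M E) (hC : D₀ * D₁ = formC x M E) :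
    XRep (P + .some x y hQ) N₁ D₁ := by
  obtain ⟨N₃, D₃, N₂, D₂, h₃, h₂, hA', hB', hC'⟩ := exists_xRep_add_sub h2 hQ hP
  obtain ⟨k, hk, rfl, rfl⟩ := h₂.unique h₀
  have key : N₃ = k * N₁ ∧ D₃ = k * D₁ := by
    rcases h₂.ne_zero with h | h
    · have h1 : N₃ = k * N₁ := mul_left_cancel₀ h (by linear_combination hA' - hA)
      exact ⟨h1, mul_left_cancel₀ h (by linear_combination hB' - hB - D₂ * h1)⟩
    · have h1 : D₃ = k * D₁ := mul_left_cancel₀ h (by linear_combination hC' - hC)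
      exact ⟨mul_left_cancel₀ h (by linear_combination hB' - hB - N₂ * h1), h1⟩
  have := h₃.smul (inv_ne_zero hk)
  rwa [key.1, key.2, inv_mul_cancel_left₀ hk, inv_mul_cancel_left₀ hk] at this

lemma XRep.relation {F : Type*} [Field F] {a b c : F} [DecidableEq F] (h2 : (2 : F) ≠ 0)
    {P : (cubicCurve a b c).Point} {x y : F}
    (hQ : (cubicCurve a b c).Nonsingular x y) {M E N₀ D₀ : F} (hP : XRep P M E)
    (h₀ : XRep (P - .some x y hQ) N₀ D₀) :
    formA a b c x M E * D₀ ^ 2 - formB a b c x M E * D₀ * N₀ + formC x M E * N₀ ^ 2 = 0 := by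
  obtain ⟨N₃, D₃, N₂, D₂, h₃, h₂, hA', hB', hC'⟩ := exists_xRep_add_sub h2 hQ hP
  obtain ⟨k, hk, rfl, rfl⟩ := h₂.unique h₀
  rw [← hA', ← hB', ← hC']
  ring

section aeval

variable {K F : Type*} [Field K] [Field F] [Algebra K F] (a b c : K) (x : F) (M E : K[X])

lemma aeval_formA : aeval x (formA (C a) (C b) (C c) X M E) =
    formA (algebraMap K F a) (algebraMap K F b) (algebraMap K F c) x (aeval x M) (aeval x E) := by
  simp [formA, map_ofNat (aeval x)]

lemma aeval_formB : aeval x (formB (C a) (C b) (C c) X M E) =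
    formB (algebraMap K F a) (algebraMap K F b) (algebraMap K F c) x (aeval x M) (aeval x E) := by
  simp [formB, map_ofNat (aeval x)]

lemma aeval_formC : aeval x (formC X M E) = formC x (aeval x M) (aeval x E) := by
  simp [formC]

end aeval

section degree

variable {K : Type*} [Field K] (a b c : K) {M E : K[X]} {d : ℕ}

lemma monic_formA (hM : M.Monic) (hd : M.natDegree = d + 1) (hE : E.natDegree ≤ d) :
    (formA (C a) (C b) (C c) X M E).Monic ∧
      (formA (C a) (C b) (C c) X M E).natDegree = 2 * d + 4 := by
  have hmon : ((M * X) ^ 2).Monic := (hM.mul monic_X).pow 2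
  have hdeg : ((M * X) ^ 2).natDegree = 2 * d + 4 := by
    rw [(hM.mul monic_X).natDegree_pow, hM.natDegree_mul monic_X, hd, natDegree_X]
    ring
  have hrest : (C (-2 * b) * (M * X) * E + C (-4 * c) * (M + E * X) * E
      + C (b ^ 2 - 4 * a * c) * E ^ 2).natDegree ≤ 2 * d + 2 := by
    have h1 : (M * X).natDegree ≤ d + 2 := by
      rw [hM.natDegree_mul monic_X, hd, natDegree_X]
    have h2 : (M + E * X).natDegree ≤ d + 1 :=
      natDegree_add_le_of_degree_le hd.le
        (natDegree_mul_le.trans (by rw [natDegree_X]; omega))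
    refine natDegree_add_le_of_degree_le (natDegree_add_le_of_degree_le ?_ ?_) ?_
    · refine natDegree_mul_le.trans ?_
      have := natDegree_C_mul_le (-2 * b) (M * X)
      omega
    · refine natDegree_mul_le.trans ?_
      have := natDegree_C_mul_le (-4 * c) (M + E * X)
      omega
    · refine (natDegree_C_mul_le _ _).trans (natDegree_pow_le.trans (by omega))
  have heq : formA (C a) (C b) (C c) X M E = (M * X) ^ 2 +
      (C (-2 * b) * (M * X) * E + C (-4 * c) * (M + E * X) * E
      + C (b ^ 2 - 4 * a * c) * E ^ 2) := by
    simp only [formA, map_mul, map_sub, map_pow, map_neg, map_ofNat]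
    ring
  rw [heq]
  have hlt : (C (-2 * b) * (M * X) * E + C (-4 * c) * (M + E * X) * E
      + C (b ^ 2 - 4 * a * c) * E ^ 2).degree < ((M * X) ^ 2).degree :=
    degree_lt_degree (by omega)
  exact ⟨hmon.add_of_left hlt, by rw [natDegree_add_eq_left_of_degree_lt hlt, hdeg]⟩

lemma natDegree_formB_le (hM : M.Monic) (hd : M.natDegree = d + 1) (hE : E.natDegree ≤ d) :
    (formB (C a) (C b) (C c) X M E).natDegree ≤ 2 * d + 3 := by
  have h1 : (M * X).natDegree ≤ d + 2 := by
    rw [hM.natDegree_mul monic_X, hd, natDegree_X]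
  have h2 : (M + E * X).natDegree ≤ d + 1 :=
    natDegree_add_le_of_degree_le hd.le
      (natDegree_mul_le.trans (by rw [natDegree_X]; omega))
  have heq : formB (C a) (C b) (C c) X M E = C 2 * (M + E * X) * (M * X)
      + C (4 * a) * (M * X) * E + C (2 * b) * (M + E * X) * E + C (4 * c) * E ^ 2 := by
    simp only [formB, map_mul, map_ofNat]
  rw [heq]
  refine natDegree_add_le_of_degree_le (natDegree_add_le_of_degree_le
    (natDegree_add_le_of_degree_le ?_ ?_) ?_) ?_
  · refine natDegree_mul_le.trans ?_
    have := natDegree_C_mul_le 2 (M + E * X)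
    omega
  · refine natDegree_mul_le.trans ?_
    have := natDegree_C_mul_le (4 * a) (M * X)
    omega
  · refine natDegree_mul_le.trans ?_
    have := natDegree_C_mul_le (2 * b) (M + E * X)
    omega
  · exact (natDegree_C_mul_le _ _).trans (natDegree_pow_le.trans (by omega))

end degree

/-- The pair `(N, D)` computes the `x`-coordinate of `n • Q` as `N(x) / D(x)`. -/
structure MulFormula {K : Type} [Field K] (a b c : K) (n : ℕ) (N D : K[X]) : Prop where
  monic : N.Monic
  natDegree_num : N.natDegree = n ^ 2
  natDegree_den : D = 0 ∨ D.natDegree < n ^ 2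
  isCoprime : IsCoprime N D
  xRep : ∀ (F : Type) [Field F] [Algebra K F] [DecidableEq F] (x y : F)
    (h : (cubicCurve (algebraMap K F a) (algebraMap K F b) (algebraMap K F c)).Nonsingular x y),
    XRep (n • Point.some x y h) (aeval x N) (aeval x D)

variable {K : Type} [Field K] [IsAlgClosed K] {a b c : K}

lemma exists_point (h2 : (2 : K) ≠ 0)
    (hsep : ∀ x : K, x ^ 3 + a * x ^ 2 + b * x + c = 0 → 3 * x ^ 2 + 2 * a * x + b ≠ 0) (x : K) :
    ∃ y, (cubicCurve a b c).Nonsingular x y := by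
  obtain ⟨y, hy⟩ := IsAlgClosed.exists_pow_nat_eq (x ^ 3 + a * x ^ 2 + b * x + c)
    (n := 2) (by norm_num)
  refine ⟨y, nonsingular_iff.mpr ⟨hy, ?_⟩⟩
  by_cases h0 : y = 0
  · exact .inl (hsep x (by rw [← hy, h0]; ring))
  · exact .inr (mul_ne_zero h2 h0)

lemma MulFormula.step (h2 : (2 : K) ≠ 0)
    (hsep : ∀ x : K, x ^ 3 + a * x ^ 2 + b * x + c = 0 → 3 * x ^ 2 + 2 * a * x + b ≠ 0)
    {n : ℕ} {N₀ D₀ M E : K[X]} (h₀ : MulFormula a b c n N₀ D₀)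
    (h₁ : MulFormula a b c (n + 1) M E) : ∃ N D, MulFormula a b c (n + 2) N D := by
  classical
  set A := formA (C a) (C b) (C c) X M E with hA
  set B := formB (C a) (C b) (C c) X M E with hB
  set G := formC X M E with hG
  have hrel : A * D₀ ^ 2 - B * D₀ * N₀ + G * N₀ ^ 2 = 0 := by
    refine Polynomial.funext fun x => ?_
    obtain ⟨y, hy⟩ := exists_point h2 hsep x
    have r₁ := h₁.xRep K x y hy
    have r₀ := h₀.xRep K x y hy
    have hsub : n • Point.some x y hy = (n + 1) • Point.some x y hy - Point.some x y hy := by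
      rw [succ_nsmul, add_sub_cancel_right]
    rw [hsub] at r₀
    have := XRep.relation h2 hy r₁ r₀
    have eA := aeval_formA a b c x M E
    have eB := aeval_formB a b c x M E
    have eG := aeval_formC x M E
    simp only [Algebra.algebraMap_self, RingHom.id_apply] at eA eB
    rw [← eA, ← eB, ← eG] at this
    simpa [coe_aeval_eq_eval] using this
  have hN₀ : N₀ ≠ 0 := h₀.monic.ne_zero
  obtain ⟨N, hN⟩ : N₀ ∣ A := by
    refine (h₀.isCoprime.pow_right (n := 2)).dvd_of_dvd_mul_right ⟨B * D₀ - G * N₀, ?_⟩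
    linear_combination hrel
  obtain ⟨D, hD⟩ : N₀ ∣ B - N * D₀ := by
    refine h₀.isCoprime.dvd_of_dvd_mul_right ⟨G, ?_⟩
    refine mul_left_cancel₀ hN₀ ?_
    linear_combination -hrel + D₀ ^ 2 * hN
  have hDG : G = D₀ * D := by
    refine mul_left_cancel₀ (pow_ne_zero 2 hN₀) ?_
    linear_combination hrel - D₀ ^ 2 * hN + N₀ * D₀ * hD
  obtain ⟨d, hd⟩ : ∃ d, (n + 1) ^ 2 = d + 1 := ⟨n ^ 2 + 2 * n, by ring⟩
  have hEd : E.natDegree ≤ d := by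
    rcases h₁.natDegree_den with h | h
    · simp [h]
    · omega
  obtain ⟨hAm, hAd⟩ := monic_formA a b c h₁.monic (h₁.natDegree_num.trans hd) hEd
  have hBd := natDegree_formB_le a b c h₁.monic (h₁.natDegree_num.trans hd) hEd
  rw [← hA] at hAm hAd
  rw [← hB] at hBd
  have hNm : N.Monic := h₀.monic.of_mul_monic_left (hN ▸ hAm)
  have hNd : N.natDegree = (n + 2) ^ 2 := by
    rw [hN, h₀.monic.natDegree_mul hNm, h₀.natDegree_num] at hAd
    nlinarith
  have hrep : ∀ (F : Type) [Field F] [Algebra K F] [DecidableEq F] (x y : F)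
      (h : (cubicCurve (algebraMap K F a) (algebraMap K F b) (algebraMap K F c)).Nonsingular x y),
      XRep ((n + 2) • Point.some x y h) (aeval x N) (aeval x D) := by
    intro F _ _ _ x y h
    have r₁ := h₁.xRep F x y h
    have r₀ := h₀.xRep F x y h
    have hsub : n • Point.some x y h = (n + 1) • Point.some x y h - Point.some x y h := by
      rw [succ_nsmul, add_sub_cancel_right]
    rw [hsub] at r₀
    rw [succ_nsmul]
    have h2F : (2 : F) ≠ 0 := by
      rw [← map_ofNat (algebraMap K F) 2]
      exact (_root_.map_ne_zero _).mpr h2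
    refine XRep.add h2F h r₁ r₀ ?_ ?_ ?_
    · rw [← aeval_formA, ← hA, hN, map_mul]
    · rw [← aeval_formB, ← hB, ← map_mul, ← map_mul, ← map_add, ← hD]
      congr 1
      ring
    · rw [← aeval_formC, ← hG, hDG, map_mul]
  refine ⟨N, D, hNm, hNd, ?_, ?_, hrep⟩
  · by_cases hD0 : D = 0
    · exact .inl hD0
    right
    have e1 : (N₀ * D).natDegree = n ^ 2 + D.natDegree := by
      rw [natDegree_mul hN₀ hD0, h₀.natDegree_num]
    have e2 : (B - N * D₀).natDegree ≤ 2 * d + 3 := by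
      refine (natDegree_sub_le _ _).trans (max_le hBd ?_)
      rcases h₀.natDegree_den with h | h
      · simp [h]
      · refine natDegree_mul_le.trans ?_
        rw [hNd]
        nlinarith
    rw [hD, e1] at e2
    nlinarith
  · refine (isCoprime_iff_aeval_ne_zero_of_isAlgClosed K K N D).mpr fun x => ?_
    obtain ⟨y, hy⟩ := exists_point h2 hsep x
    exact (hrep K x y hy).ne_zero

/-- Multiplication by `n` on the curve is given by coprime polynomials on `x`-coordinates. -/
theorem exists_mulFormula (h2 : (2 : K) ≠ 0)
    (hsep : ∀ x : K, x ^ 3 + a * x ^ 2 + b * x + c = 0 → 3 * x ^ 2 + 2 * a * x + b ≠ 0) (n : ℕ) :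
    ∃ N D, MulFormula a b c n N D := by
  have h0 : MulFormula a b c 0 1 0 :=
    ⟨monic_one, by simp, .inl rfl, isCoprime_one_left, fun F _ _ _ x y h => by
      rw [zero_nsmul, xRep_zero]; simp⟩
  have h1 : MulFormula a b c 1 X 1 :=
    ⟨monic_X, by simp, .inr (by simp), isCoprime_one_right, fun F _ _ _ x y h => by
      rw [one_nsmul, xRep_some]; simp⟩
  have : (∃ N D, MulFormula a b c n N D) ∧ ∃ N D, MulFormula a b c (n + 1) N D := by
    induction n with
    | zero => exact ⟨⟨_, _, h0⟩, ⟨_, _, h1⟩⟩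
    | succ n ih =>
      obtain ⟨⟨N₀, D₀, h₀⟩, M, E, h₁⟩ := ih
      exact ⟨⟨M, E, h₁⟩, h₀.step h2 hsep h₁⟩
  exact this.1

end cubicCurve

namespace cubicCurve

section hasse

variable {K : Type*} [Field K] (p : ℕ) [CharP K p] (a b c : K)

/-- If the Hasse invariant of `y² = f(x)` vanishes, then `f^((p-1)/2)` yields a polynomial `u`
with `2 f u' + f' u` constant. -/
lemma exists_of_hasse [Fact p.Prime] (hp : 5 ≤ p)
    (hH : ((X ^ 3 + C a * X ^ 2 + C b * X + C c) ^ ((p - 1) / 2) : K[X]).coeff (p - 1) = 0) :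
    ∃ (u : K[X]) (k : K), u.Monic ∧ 2 * u.natDegree + 3 = p ∧
      2 * (X ^ 3 + C a * X ^ 2 + C b * X + C c) * derivative u +
        (3 * X ^ 2 + 2 * C a * X + C b) * u = C k := by
  have hodd : p % 2 = 1 := by
    rcases (Fact.out : p.Prime).eq_two_or_odd with h | h <;> omega
  obtain ⟨m, hm⟩ : ∃ m, p = 2 * m + 1 := ⟨p / 2, by omega⟩
  have hm' : (p - 1) / 2 = m := by omega
  rw [hm'] at hH
  set f : K[X] := X ^ 3 + C a * X ^ 2 + C b * X + C c with hf
  have hfm : f.Monic := by rw [hf]; monicity!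
  have hfd : f.natDegree = 3 := by rw [hf]; compute_degree!
  have hf' : derivative f = 3 * X ^ 2 + 2 * C a * X + C b := by
    rw [hf]; simp [derivative_pow, map_ofNat C]; ring
  have hXm : (X ^ p : K[X]).Monic := monic_X_pow p
  set u := f ^ m /ₘ X ^ p with hu
  set w := f ^ m %ₘ X ^ p with hw
  have hdiv : w + X ^ p * u = f ^ m := modByMonic_add_div _ _
  have hfmd : (f ^ m).natDegree = 3 * m := by rw [hfm.natDegree_pow, hfd]; ring
  have hwp : w.degree < p := by
    have := degree_modByMonic_lt (f ^ m) hXm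
    rwa [degree_X_pow] at this
  have hwc : w.coeff (p - 1) = 0 := by
    rw [← hdiv, coeff_add, coeff_X_pow_mul', if_neg (by omega), add_zero] at hH
    exact hH
  have hwd : w.natDegree ≤ p - 2 := by
    rw [natDegree_le_iff_coeff_eq_zero]
    intro N hN
    rcases eq_or_ne N (p - 1) with rfl | h
    · exact hwc
    · exact coeff_eq_zero_of_degree_lt (hwp.trans_le (by exact_mod_cast (by omega : p ≤ N)))
  have hud : u.natDegree = 3 * m - p := by
    rw [hu, natDegree_divByMonic _ hXm, hfmd, natDegree_X_pow]
  have hum : u.Monic := by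
    rw [Monic, hu, leadingCoeff_divByMonic_of_monic hXm]
    · exact hfm.pow m
    · rw [degree_X_pow, degree_eq_natDegree (hfm.pow m).ne_zero, hfmd]
      exact_mod_cast (by omega)
  have h2m : (2 : K[X]) * (m : K[X]) = -1 := by
    have : ((p : ℕ) : K[X]) = 0 := CharP.cast_eq_zero _ _
    rw [hm] at this
    push_cast at this
    linear_combination this
  have hXp : derivative (X ^ p : K[X]) = 0 := by
    simp [derivative_X_pow]
  have hode : 2 * f * derivative (f ^ m) = -(derivative f * f ^ m) := by
    obtain ⟨j, rfl⟩ : ∃ j, m = j + 1 := ⟨m - 1, by omega⟩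
    rw [derivative_pow, Nat.add_sub_cancel, map_natCast]
    linear_combination derivative f * f ^ (j + 1) * h2m
  have hkey : X ^ p * (2 * f * derivative u + derivative f * u) =
      -(2 * f * derivative w + derivative f * w) := by
    rw [← hdiv, derivative_add, derivative_mul, hXp] at hode
    linear_combination hode
  have hw'd : (derivative w).natDegree ≤ p - 3 := (natDegree_derivative_le w).trans (by omega)
  have hf'd : (derivative f).natDegree ≤ 2 := (natDegree_derivative_le f).trans (by omega)
  have hrd : (-(2 * f * derivative w + derivative f * w)).natDegree ≤ p := by
    rw [natDegree_neg]
    refine natDegree_add_le_of_degree_le ?_ ?_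
    · rw [mul_assoc, ← map_ofNat C 2]
      refine (natDegree_C_mul_le _ _).trans (natDegree_mul_le.trans ?_)
      omega
    · exact natDegree_mul_le.trans (by omega)
  rw [← hkey] at hrd
  have hconst : (2 * f * derivative u + derivative f * u).natDegree = 0 := by
    by_cases h0 : 2 * f * derivative u + derivative f * u = 0
    · rw [h0, natDegree_zero]
    · rw [natDegree_mul hXm.ne_zero h0, natDegree_X_pow] at hrd
      omega
  exact ⟨u, _, hum, by omega, by rw [← hf']; exact eq_C_of_natDegree_eq_zero hconst⟩

variable {a b c}

lemma hasse_const_ne_zero [IsAlgClosed K]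
    (hsep : ∀ x : K, x ^ 3 + a * x ^ 2 + b * x + c = 0 → 3 * x ^ 2 + 2 * a * x + b ≠ 0)
    {u : K[X]} {k : K} (hu : u.Monic) (hdeg : 2 * u.natDegree + 3 = p)
    (hode : 2 * (X ^ 3 + C a * X ^ 2 + C b * X + C c) * derivative u +
        (3 * X ^ 2 + 2 * C a * X + C b) * u = C k) : k ≠ 0 := by
  rintro rfl
  obtain ⟨e, he⟩ := IsAlgClosed.exists_root (X ^ 3 + C a * X ^ 2 + C b * X + C c : K[X])
    (by rw [show (X ^ 3 + C a * X ^ 2 + C b * X + C c : K[X]).degree = 3 by compute_degree!]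
        norm_num)
  have he' : e ^ 3 + a * e ^ 2 + b * e + c = 0 := by simpa using he
  obtain ⟨g, hg⟩ := dvd_iff_isRoot.mpr he
  obtain ⟨v, hv, hnd⟩ := exists_eq_pow_rootMultiplicity_mul_and_not_dvd u hu.ne_zero e
  generalize u.rootMultiplicity e = n at hv
  have hn : n ≤ u.natDegree := by
    have hv0 : v ≠ 0 := by
      rintro rfl
      exact hnd (dvd_zero _)
    rw [hv, ((monic_X_sub_C e).pow n).natDegree_mul' hv0, natDegree_pow,
      natDegree_X_sub_C, mul_one]
    exact Nat.le_add_right _ _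
  have hge : g.eval e ≠ 0 := by
    have := congrArg (fun q => (derivative q).eval e) hg
    simp [derivative_pow] at this
    rw [← this]
    have := hsep e he'
    contrapose! this
    linear_combination this
  have hve : v.eval e ≠ 0 := fun h => hnd (dvd_iff_isRoot.mpr h)
  have hder : (X - C e) * derivative u =
      (X - C e) ^ n * ((n : K[X]) * v + (X - C e) * derivative v) := by
    rw [hv, derivative_mul]
    rcases n with _ | j
    · simp
    · rw [derivative_X_sub_C_pow, Nat.add_sub_cancel, map_natCast]
      ring
  have hfder : (3 * X ^ 2 + 2 * C a * X + C b : K[X]) = g + (X - C e) * derivative g := by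
    have := congrArg derivative hg
    simp [derivative_pow, map_ofNat C] at this
    linear_combination this
  have hkey : (X - C e) ^ n * (2 * g * ((n : K[X]) * v + (X - C e) * derivative v) +
      (g + (X - C e) * derivative g) * v) = 0 := by
    rw [hg, hfder, map_zero] at hode
    linear_combination hode - 2 * g * hder - (g + (X - C e) * derivative g) * hv
  have hkey2 := (mul_eq_zero.mp hkey).resolve_left (pow_ne_zero _ (X_sub_C_ne_zero e))
  have := congrArg (eval e) hkey2
  simp at this
  have h3 : (2 * n + 1 : K) = 0 := by
    have h4 : (g.eval e * v.eval e) * (2 * n + 1 : K) = 0 := by linear_combination this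
    exact (mul_eq_zero.mp h4).resolve_left (mul_ne_zero hge hve)
  have h5 : p ∣ 2 * n + 1 := (CharP.cast_eq_zero_iff K p _).mp (by exact_mod_cast h3)
  have := Nat.le_of_dvd (by omega) h5
  omega

end hasse

end cubicCurve

namespace cubicCurve

section sequences

variable {R : Type*} [CommRing R]

/-- The complete homogeneous sequence (shifted by two) with elementary symmetric
functions `e₁, e₂, e₃`. -/
def hseq (e₁ e₂ e₃ : R) : ℕ → R
  | 0 => 0
  | 1 => 0
  | 2 => 1
  | n + 3 => e₁ * hseq e₁ e₂ e₃ (n + 2) - e₂ * hseq e₁ e₂ e₃ (n + 1) + e₃ * hseq e₁ e₂ e₃ n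

/-- The power sums with elementary symmetric functions `e₁, e₂, e₃`. -/
def pseq (e₁ e₂ e₃ : R) (n : ℕ) : R :=
  3 * hseq e₁ e₂ e₃ (n + 2) - 2 * e₁ * hseq e₁ e₂ e₃ (n + 1) + e₂ * hseq e₁ e₂ e₃ n

variable (e₁ e₂ e₃ : R)

lemma hseq_add_three (n : ℕ) : hseq e₁ e₂ e₃ (n + 3) =
    e₁ * hseq e₁ e₂ e₃ (n + 2) - e₂ * hseq e₁ e₂ e₃ (n + 1) + e₃ * hseq e₁ e₂ e₃ n := rfl

@[simp] lemma hseq_zero : hseq e₁ e₂ e₃ 0 = 0 := rfl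
@[simp] lemma hseq_one : hseq e₁ e₂ e₃ 1 = 0 := rfl
@[simp] lemma hseq_two : hseq e₁ e₂ e₃ 2 = 1 := rfl

lemma pseq_add_three (n : ℕ) : pseq e₁ e₂ e₃ (n + 3) =
    e₁ * pseq e₁ e₂ e₃ (n + 2) - e₂ * pseq e₁ e₂ e₃ (n + 1) + e₃ * pseq e₁ e₂ e₃ n := by
  simp only [pseq, hseq_add_three]
  ring

lemma pseq_zero : pseq e₁ e₂ e₃ 0 = 3 := by simp [pseq]

lemma pseq_one : pseq e₁ e₂ e₃ 1 = e₁ := by simp [pseq, hseq_add_three]; ring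

lemma pseq_two : pseq e₁ e₂ e₃ 2 = e₁ ^ 2 - 2 * e₂ := by simp [pseq, hseq_add_three]; ring

/-- A sequence with the initial values and recurrence of the power sums is a power sum. -/
lemma eq_power_sum {g : ℕ → R} {x₁ x₂ x₃ : R} (h₀ : g 0 = 3) (h₁ : g 1 = x₁ + x₂ + x₃)
    (h₂ : g 2 = x₁ ^ 2 + x₂ ^ 2 + x₃ ^ 2)
    (h : ∀ n, g (n + 3) = (x₁ + x₂ + x₃) * g (n + 2) - (x₁ * x₂ + x₁ * x₃ + x₂ * x₃) * g (n + 1)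
      + x₁ * x₂ * x₃ * g n) (n : ℕ) : g n = x₁ ^ n + x₂ ^ n + x₃ ^ n := by
  induction n using Nat.strong_induction_on with
  | _ n ih =>
    rcases n with _ | _ | _ | n
    · rw [h₀]; norm_num
    · simpa using h₁
    · simpa using h₂
    · rw [h, ih (n + 2) (by omega), ih (n + 1) (by omega), ih n (by omega)]
      ring

lemma derivation_pseq (D : Derivation ℤ R R) (n : ℕ) :
    D (pseq e₁ e₂ e₃ (n + 1)) = (n + 1 : ℕ) * (D e₁ * hseq e₁ e₂ e₃ (n + 2)
      - D e₂ * hseq e₁ e₂ e₃ (n + 1) + D e₃ * hseq e₁ e₂ e₃ n) := by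
  induction n using Nat.strong_induction_on with
  | _ n ih =>
    rcases n with _ | _ | _ | n
    · simp [pseq_one]
    · rw [show pseq e₁ e₂ e₃ (0 + 1 + 1) = e₁ * e₁ - (e₂ + e₂) by rw [pseq_two]; ring]
      simp [hseq_add_three]
      ring
    · rw [show pseq e₁ e₂ e₃ (0 + 1 + 1 + 1) =
        e₁ * (e₁ * e₁ - (e₂ + e₂)) - e₂ * e₁ + (e₃ + e₃ + e₃) by
          refine (pseq_add_three e₁ e₂ e₃ 0).trans ?_
          rw [zero_add, zero_add, pseq_zero, pseq_one, pseq_two]; ring]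
      simp [hseq_add_three]
      ring
    · rw [show n + 1 + 1 + 1 + 1 = (n + 1) + 3 from rfl, pseq_add_three, map_add, map_sub,
        Derivation.leibniz, Derivation.leibniz, Derivation.leibniz, ih (n + 2) (by omega),
        ih (n + 1) (by omega), ih n (by omega)]
      simp only [pseq, hseq_add_three, smul_eq_mul]
      push_cast
      ring

variable {a b c l n t : R} {D : Derivation ℤ R R}

/-- The trace of `(l t x + n t³) x^k` over the roots of `f(x) - (l t x + n t³)²`. -/
def traceSeq (a b c l n t : R) (k : ℕ) : R :=
  l * t * pseq (l ^ 2 * t ^ 2 - a) (b - 2 * l * n * t ^ 4) (n ^ 2 * t ^ 6 - c) (k + 1) +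
    n * t ^ 3 * pseq (l ^ 2 * t ^ 2 - a) (b - 2 * l * n * t ^ 4) (n ^ 2 * t ^ 6 - c) k

/-- The residue of `(l x + 3 n t²) x^k` along the roots of `f(x) - (l t x + n t³)²`. -/
def residueSeq (a b c l n t : R) (k : ℕ) : R :=
  l * hseq (l ^ 2 * t ^ 2 - a) (b - 2 * l * n * t ^ 4) (n ^ 2 * t ^ 6 - c) (k + 1) +
    3 * n * t ^ 2 * hseq (l ^ 2 * t ^ 2 - a) (b - 2 * l * n * t ^ 4) (n ^ 2 * t ^ 6 - c) k

lemma derivation_e₁ (ha : D a = 0) (hl : D l = 0) (ht : D t = 1) : D (l ^ 2 * t ^ 2 - a) =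
  2 * l ^ 2 * t := by
  simp [Derivation.leibniz_pow, ha, hl, ht]
  ring

lemma derivation_e₂ (hb : D b = 0) (hl : D l = 0) (hn : D n = 0) (ht : D t = 1) :
    D (b - 2 * l * n * t ^ 4) = -8 * l * n * t ^ 3 := by
  rw [show b - 2 * l * n * t ^ 4 = b - (l * n * t ^ 4 + l * n * t ^ 4) by ring]
  simp [Derivation.leibniz_pow, hb, hl, hn, ht]
  ring

lemma derivation_e₃ (hc : D c = 0) (hn : D n = 0) (ht : D t = 1) :
    D (n ^ 2 * t ^ 6 - c) = 6 * n ^ 2 * t ^ 5 := by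
  simp [Derivation.leibniz_pow, hc, hn, ht]
  ring

lemma derivation_traceSeq_zero (ha : D a = 0) (hl : D l = 0) (hn : D n = 0) (ht : D t = 1) :
    D (traceSeq a b c l n t 0) =
    3 * residueSeq a b c l n t 2 + 2 * a * residueSeq a b c l n t 1 +
      b * residueSeq a b c l n t 0 := by
  have h3 : D (3 : R) = 0 := by exact_mod_cast D.map_natCast 3
  simp only [traceSeq, residueSeq, pseq_zero, pseq_one, zero_add, one_add_one_eq_two, map_add,
    Derivation.leibniz,
    Derivation.leibniz_pow, derivation_e₁ ha hl ht, h3, hl, hn, ht, hseq_add_three, smul_eq_mul,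
    nsmul_eq_mul, hseq_zero, hseq_one, hseq_two]
  push_cast
  ring

lemma derivation_traceSeq_succ (ha : D a = 0) (hb : D b = 0) (hc : D c = 0) (hl : D l = 0)
    (hn : D n = 0) (ht : D t = 1) (k : ℕ) :
    D (traceSeq a b c l n t (k + 1)) =
    3 * residueSeq a b c l n t (k + 3) + 2 * a * residueSeq a b c l n t (k + 2) +
      b * residueSeq a b c l n t (k + 1) + 2 * (k + 1) * (residueSeq a b c l n t (k + 3) +
      a * residueSeq a b c l n t (k + 2) + b * residueSeq a b c l n t (k + 1) +
      c * residueSeq a b c l n t k) := by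
  have e1 := derivation_e₁ ha hl ht
  have e2 := derivation_e₂ hb hl hn ht
  have e3 := derivation_e₃ hc hn ht
  simp only [traceSeq, residueSeq, map_add, Derivation.leibniz, derivation_pseq, e1, e2, e3,
    Derivation.leibniz_pow, hl, hn, ht, smul_eq_mul, nsmul_eq_mul]
  simp only [pseq, hseq_add_three]
  push_cast
  ring

end sequences

section deformation

variable {L : Type*} [Field L]

/-- The linear map sending `X ^ k` to `g k`. -/
noncomputable def ofSeq (g : ℕ → L[X]) : L[X] →ₗ[L] L[X] :=
  lsum fun k => LinearMap.toSpanSingleton L L[X] (g k)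

lemma ofSeq_apply (g : ℕ → L[X]) (q : L[X]) : ofSeq g q = q.sum fun k r => C r * g k := by
  simp [ofSeq, smul_eq_C_mul]

lemma ofSeq_monomial (g : ℕ → L[X]) (k : ℕ) (r : L) : ofSeq g (monomial k r) = C r * g k := by
  rw [ofSeq_apply, sum_monomial_index]
  simp

variable (a b c l n : L)

lemma derivative_ofSeq_traceSeq (u : L[X]) :
    derivative (ofSeq (traceSeq (C a) (C b) (C c) (C l) (C n) X) u) =
      ofSeq (residueSeq (C a) (C b) (C c) (C l) (C n) X)
        (2 * (X ^ 3 + C a * X ^ 2 + C b * X + C c) * derivative u +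
          (3 * X ^ 2 + 2 * C a * X + C b) * u) := by
  induction u using Polynomial.induction_on' with
  | add q r hq hr => rw [map_add, derivative_add, hq, hr, ← map_add, derivative_add]; congr 1; ring
  | monomial k r =>
    let D : Derivation ℤ L[X] L[X] := (derivative' (R := L)).restrictScalars ℤ
    have hD : ∀ q, D q = derivative q := fun _ => rfl
    have hC : ∀ r, D (C r) = 0 := fun r => by rw [hD, derivative_C]
    have hX : D X = 1 := by rw [hD, derivative_X]
    rw [ofSeq_monomial, derivative_C_mul]
    have h2 : (2 : L[X]) = C 2 := by simp [map_ofNat C]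
    have h3 : (3 : L[X]) = C 3 := by simp [map_ofNat C]
    rcases k with _ | k
    · have := derivation_traceSeq_zero (b := C b) (c := C c) (hC a) (hC l) (hC n) hX
      change derivative _ = _ at this
      rw [this, show 2 * (X ^ 3 + C a * X ^ 2 + C b * X + C c) * derivative (monomial 0 r) +
          (3 * X ^ 2 + 2 * C a * X + C b) * monomial 0 r =
          monomial 2 (r * 3) + monomial 1 (r * (2 * a)) + monomial 0 (r * b) by
        simp only [← C_mul_X_pow_eq_monomial, map_mul, h2, h3]
        simp
        ring]
      simp only [map_add, ofSeq_monomial, map_mul, h2, h3]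
      ring
    · have := derivation_traceSeq_succ (hC a) (hC b) (hC c) (hC l) (hC n) hX k
      change derivative _ = _ at this
      rw [this, show 2 * (X ^ 3 + C a * X ^ 2 + C b * X + C c) * derivative (monomial (k + 1) r) +
          (3 * X ^ 2 + 2 * C a * X + C b) * monomial (k + 1) r =
          monomial (k + 3) (r * (3 + 2 * (k + 1))) + monomial (k + 2) (r * (2 * a + 2 * (k + 1) * a))
            + monomial (k + 1) (r * (b + 2 * (k + 1) * b)) + monomial k (r * (2 * (k + 1) * c)) by
        simp only [← C_mul_X_pow_eq_monomial, map_mul, map_add, h2, h3]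
        simp
        ring]
      simp only [map_add, ofSeq_monomial, map_mul, h2, h3, map_natCast, map_one]
      ring

lemma natDegree_pseq_le {e₁ e₂ e₃ : L[X]} (h₁ : e₁.natDegree ≤ 2) (h₂ : e₂.natDegree ≤ 4)
    (h₃ : e₃.natDegree ≤ 6) (k : ℕ) : (pseq e₁ e₂ e₃ k).natDegree ≤ 2 * k := by
  induction k using Nat.strong_induction_on with
  | _ k ih =>
    rcases k with _ | _ | _ | k
    · rw [pseq_zero]; compute_degree!
    · rw [zero_add, pseq_one]; exact h₁
    · rw [zero_add, one_add_one_eq_two, pseq_two, ← map_ofNat C 2]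
      refine (natDegree_sub_le _ _).trans (max_le (natDegree_pow_le.trans (by omega))
        ((natDegree_C_mul_le _ _).trans (by omega)))
    · rw [show k + 1 + 1 + 1 = k + 3 from rfl, pseq_add_three]
      have i1 := ih (k + 2) (by omega)
      have i2 := ih (k + 1) (by omega)
      have i3 := ih k (by omega)
      refine natDegree_add_le_of_degree_le ((natDegree_sub_le _ _).trans (max_le ?_ ?_)) ?_ <;>
        exact natDegree_mul_le.trans (by omega)

lemma coeff_pseq {e₁ e₂ e₃ : L[X]} (h₁ : e₁.natDegree ≤ 2) (h₂ : e₂.natDegree ≤ 4)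
    (h₃ : e₃.natDegree ≤ 6) (k : ℕ) : (pseq e₁ e₂ e₃ k).coeff (2 * k) =
      pseq (e₁.coeff 2) (e₂.coeff 4) (e₃.coeff 6) k := by
  induction k using Nat.strong_induction_on with
  | _ k ih =>
    rcases k with _ | _ | _ | k
    · rw [pseq_zero, pseq_zero]; simp
    · rw [zero_add, pseq_one, pseq_one, mul_one]
    · rw [zero_add, one_add_one_eq_two, pseq_two, pseq_two, ← map_ofNat C 2, coeff_sub, coeff_C_mul,
        sq, show 2 * 2 = 2 + 2 from rfl, coeff_mul_add_eq_of_natDegree_le h₁ h₁, ← sq]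
    · rw [show k + 1 + 1 + 1 = k + 3 from rfl, pseq_add_three, pseq_add_three, coeff_add, coeff_sub]
      have i1 := natDegree_pseq_le h₁ h₂ h₃ (k + 2)
      have i2 := natDegree_pseq_le h₁ h₂ h₃ (k + 1)
      have i3 := natDegree_pseq_le h₁ h₂ h₃ k
      rw [show 2 * (k + 3) = 2 + 2 * (k + 2) by ring, coeff_mul_add_eq_of_natDegree_le h₁ i1,
        show 2 + 2 * (k + 2) = 4 + 2 * (k + 1) by ring, coeff_mul_add_eq_of_natDegree_le h₂ i2,
        show 4 + 2 * (k + 1) = 6 + 2 * k by ring, coeff_mul_add_eq_of_natDegree_le h₃ i3,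
        ih (k + 2) (by omega), ih (k + 1) (by omega), ih k (by omega)]

lemma natDegree_traceSeq_le (k : ℕ) :
    (traceSeq (C a) (C b) (C c) (C l) (C n) X k).natDegree ≤ 2 * k + 3 ∧
      (traceSeq (C a) (C b) (C c) (C l) (C n) X k).coeff (2 * k + 3) =
        l * pseq (l ^ 2) (-(2 * l * n)) (n ^ 2) (k + 1) + n * pseq (l ^ 2) (-(2 * l * n)) (n ^ 2) k := by
  have h2 : (2 : L[X]) = C 2 := by simp [map_ofNat C]
  have h₁ : (C l ^ 2 * X ^ 2 - C a : L[X]).natDegree ≤ 2 := by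
    rw [← C_pow]; compute_degree
  have h₂ : (C b - 2 * C l * C n * X ^ 4 : L[X]).natDegree ≤ 4 := by
    rw [h2, ← C_mul, ← C_mul]; compute_degree
  have h₃ : (C n ^ 2 * X ^ 6 - C c : L[X]).natDegree ≤ 6 := by
    rw [← C_pow]; compute_degree
  have c₁ : (C l ^ 2 * X ^ 2 - C a : L[X]).coeff 2 = l ^ 2 := by
    rw [← C_pow, coeff_sub]; simp [-map_pow]
  have c₂ : (C b - 2 * C l * C n * X ^ 4 : L[X]).coeff 4 = -(2 * l * n) := by
    rw [h2, ← C_mul, ← C_mul]; simp [-map_mul]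
  have c₃ : (C n ^ 2 * X ^ 6 - C c : L[X]).coeff 6 = n ^ 2 := by
    rw [← C_pow, coeff_sub]; simp [-map_pow]
  have p1 := natDegree_pseq_le h₁ h₂ h₃ (k + 1)
  have p0 := natDegree_pseq_le h₁ h₂ h₃ k
  have q1 := coeff_pseq h₁ h₂ h₃ (k + 1)
  have q0 := coeff_pseq h₁ h₂ h₃ k
  rw [c₁, c₂, c₃] at q1 q0
  have d1 : (C l * X : L[X]).natDegree ≤ 1 := by compute_degree
  have d3 : (C n * X ^ 3 : L[X]).natDegree ≤ 3 := by compute_degree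
  constructor
  · refine natDegree_add_le_of_degree_le ?_ ?_ <;> exact natDegree_mul_le.trans (by omega)
  · rw [traceSeq, coeff_add, show 2 * k + 3 = 1 + 2 * (k + 1) by ring,
      coeff_mul_add_eq_of_natDegree_le d1 p1, show 1 + 2 * (k + 1) = 3 + 2 * k by ring,
      coeff_mul_add_eq_of_natDegree_le d3 p0, q1, q0]
    simp

lemma cusp_identity (p : ℕ) [Fact p.Prime] [CharP L p] {k : ℕ} (hk : 2 * k + 3 = p) :
    l * pseq (l ^ 2) (-(2 * l * n)) (n ^ 2) (k + 1) + n * pseq (l ^ 2) (-(2 * l * n)) (n ^ 2) k =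
      l ^ p := by
  let i := algebraMap L (AlgebraicClosure L)
  have : CharP (AlgebraicClosure L) p := charP_of_injective_algebraMap i.injective p
  obtain ⟨w₁, hw₁⟩ := IsAlgClosed.exists_root (X ^ 3 - C (i l) * X ^ 2 - C (i n)) (by
    have : (X ^ 3 - C (i l) * X ^ 2 - C (i n)).degree = 3 := by compute_degree!
    rw [this]; norm_num)
  obtain ⟨w₂, hw₂⟩ := IsAlgClosed.exists_root (X ^ 2 - C (i l - w₁) * X - C (w₁ * (i l - w₁))) (by
    have : (X ^ 2 - C (i l - w₁) * X - C (w₁ * (i l - w₁))).degree = 2 := by compute_degree!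
    rw [this]; norm_num)
  simp only [IsRoot, eval_sub, eval_pow, eval_mul, eval_X, eval_C] at hw₁ hw₂
  obtain ⟨w₃, hw₃⟩ : ∃ w₃, w₁ + w₂ + w₃ = i l := ⟨i l - w₁ - w₂, by ring⟩
  have s2 : w₁ * w₂ + w₁ * w₃ + w₂ * w₃ = 0 := by
    rw [← hw₃] at hw₂
    linear_combination -hw₂
  have s3 : w₁ * w₂ * w₃ = i n := by
    linear_combination hw₁ + w₁ * s2 - w₁ ^ 2 * hw₃
  have hP : ∀ j, i (pseq (l ^ 2) (-(2 * l * n)) (n ^ 2) j) =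
      (w₁ ^ 2) ^ j + (w₂ ^ 2) ^ j + (w₃ ^ 2) ^ j := by
    have f1 : i l ^ 2 = w₁ ^ 2 + w₂ ^ 2 + w₃ ^ 2 := by
      rw [← hw₃]; linear_combination 2 * s2
    have f2 : -(2 * i l * i n) = w₁ ^ 2 * w₂ ^ 2 + w₁ ^ 2 * w₃ ^ 2 + w₂ ^ 2 * w₃ ^ 2 := by
      rw [← hw₃, ← s3]
      linear_combination -(w₁ * w₂ + w₁ * w₃ + w₂ * w₃) * s2
    have f3 : i n ^ 2 = w₁ ^ 2 * w₂ ^ 2 * w₃ ^ 2 := by rw [← s3]; ring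
    refine eq_power_sum ?_ ?_ ?_ fun j => ?_
    · rw [pseq_zero, map_ofNat]
    · rw [pseq_one, ← f1, map_pow]
    · rw [pseq_two]
      simp only [map_sub, map_pow, map_mul, map_neg, map_ofNat]
      rw [f1, f2]; ring
    · rw [pseq_add_three]
      simp only [map_sub, map_add, map_pow, map_mul, map_neg, map_ofNat]
      rw [← f1, ← f2, ← f3]
  apply i.injective
  rw [map_add, map_mul, map_mul, hP, hP, map_pow, ← hw₃, add_pow_char, add_pow_char, ← hk]
  have hw : ∀ w : AlgebraicClosure L, w ^ 3 = i l * w ^ 2 + i n →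
      i l * (w ^ 2) ^ (k + 1) + i n * (w ^ 2) ^ k = w ^ (2 * k + 3) := by
    intro w hw
    linear_combination -(w ^ 2) ^ k * hw
  have g1 := hw w₁ (by linear_combination hw₁)
  have g2 := hw w₂ (by rw [← hw₃, ← s3]; linear_combination -w₂ * s2)
  have g3 := hw w₃ (by rw [← hw₃, ← s3]; linear_combination -w₃ * s2)
  linear_combination g1 + g2 + g3 +
    ((w₁ ^ 2) ^ (k + 1) + (w₂ ^ 2) ^ (k + 1) + (w₃ ^ 2) ^ (k + 1)) * hw₃

/-- The sum of `s(x) u(x)` over the intersection of the curve with the line `s = l x + n`. -/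
theorem sum_line_mul_eval (p : ℕ) [Fact p.Prime] [CharP L p] {a b c l n k x₁ x₂ x₃ : L} {u : L[X]}
    (hu : u.Monic) (hdeg : 2 * u.natDegree + 3 = p)
    (hode : 2 * (X ^ 3 + C a * X ^ 2 + C b * X + C c) * derivative u +
        (3 * X ^ 2 + 2 * C a * X + C b) * u = C k)
    (h₁ : x₁ + x₂ + x₃ = l ^ 2 - a) (h₂ : x₁ * x₂ + x₁ * x₃ + x₂ * x₃ = b - 2 * l * n)
    (h₃ : x₁ * x₂ * x₃ = n ^ 2 - c) :
    (l * x₁ + n) * u.eval x₁ + (l * x₂ + n) * u.eval x₂ + (l * x₃ + n) * u.eval x₃ = l ^ p := by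
  set T := traceSeq (C a) (C b) (C c) (C l) (C n) X with hT
  have hp0 : 0 < p := (Fact.out : p.Prime).pos
  set S := ofSeq T u - C (l ^ p) * X ^ p with hS
  have hTr : ofSeq T u = ∑ j ∈ u.support, C (u.coeff j) * T j := by
    rw [ofSeq_apply, sum_def]
  have hder : derivative S = 0 := by
    rw [hS, derivative_sub, derivative_ofSeq_traceSeq, hode, ← monomial_zero_left (a := k),
      ofSeq_monomial,
      derivative_C_mul, derivative_X_pow]
    simp [residueSeq]
  have hTd : ∀ j ∈ u.support, (C (u.coeff j) * T j).natDegree ≤ 2 * j + 3 ∧ j ≤ u.natDegree :=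
    fun j hj => ⟨(natDegree_C_mul_le _ _).trans (natDegree_traceSeq_le a b c l n j).1,
      le_natDegree_of_mem_supp j hj⟩
  have hSd : S.natDegree ≤ p := by
    refine (natDegree_sub_le _ _).trans (max_le ?_ (natDegree_C_mul_X_pow_le _ _))
    rw [hTr]
    refine natDegree_sum_le_of_forall_le _ _ fun j hj => ?_
    have := hTd j hj
    omega
  have hSp : S.coeff p = 0 := by
    rw [hS, hTr, coeff_sub, finsetSum_coeff, Finset.sum_eq_single u.natDegree]
    · rw [coeff_C_mul, coeff_C_mul, coeff_X_pow_self, hu.coeff_natDegree, ← hdeg,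
        (natDegree_traceSeq_le a b c l n _).2, hdeg, cusp_identity l n p hdeg]
      ring
    · intro j hj hne
      have := hTd j hj
      exact coeff_eq_zero_of_natDegree_lt (by omega)
    · intro h
      simp only [mem_support_iff, not_not] at h
      simp [h]
  have hS0 : S.coeff 0 = 0 := by
    rw [coeff_zero_eq_eval_zero, hS, hTr, eval_sub, eval_finsetSum,
      Finset.sum_eq_zero fun j _ => by simp [hT, traceSeq]]
    simp [hp0.ne']
  have hSz : S = 0 := by
    ext j
    rw [coeff_zero]
    rcases lt_trichotomy j p with h | h | h
    · rcases j with _ | j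
      · exact hS0
      · have := congrArg (fun q => q.coeff j) hder
        simp only [coeff_derivative, coeff_zero] at this
        refine (mul_eq_zero.mp this).resolve_right fun h0 => ?_
        have h5 : p ∣ j + 1 := (CharP.cast_eq_zero_iff L p _).mp (by exact_mod_cast h0)
        have := Nat.le_of_dvd (by omega) h5
        omega
    · rw [h]; exact hSp
    · exact coeff_eq_zero_of_natDegree_lt (by omega)
  have hP : ∀ j, (pseq (C l ^ 2 * X ^ 2 - C a) (C b - 2 * C l * C n * X ^ 4)
      (C n ^ 2 * X ^ 6 - C c) j).eval 1 = x₁ ^ j + x₂ ^ j + x₃ ^ j := by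
    refine eq_power_sum ?_ ?_ ?_ fun j => ?_
    · simp [pseq_zero]
    · simp [pseq_one, h₁]
    · simp only [pseq_two, eval_sub, eval_pow, eval_mul, eval_C, eval_X, one_pow, mul_one,
        eval_ofNat]
      rw [← h₁, ← h₂]; ring
    · simp only [pseq_add_three, eval_add, eval_sub, eval_pow, eval_mul, eval_C, eval_X, one_pow,
        mul_one, eval_ofNat]
      rw [← h₁, ← h₂, ← h₃]
  have hT1 : ∀ j, (T j).eval 1 = (l * x₁ + n) * x₁ ^ j + (l * x₂ + n) * x₂ ^ j +
      (l * x₃ + n) * x₃ ^ j := by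
    intro j
    simp only [hT, traceSeq, eval_add, eval_mul, eval_C, eval_X, eval_pow, hP]
    ring
  have hfin := congrArg (eval 1) hSz
  rw [hS, hTr, eval_sub, eval_finsetSum] at hfin
  simp only [eval_mul, eval_C, hT1, eval_pow, eval_X, one_pow, mul_one, eval_zero] at hfin
  rw [← sub_eq_zero, ← hfin, eval_eq_sum, eval_eq_sum, eval_eq_sum, sum_def, sum_def, sum_def,
    Finset.mul_sum, Finset.mul_sum, Finset.mul_sum, ← Finset.sum_add_distrib,
    ← Finset.sum_add_distrib]
  congr 1
  exact Finset.sum_congr rfl fun j _ => by ring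

end deformation

end cubicCurve

namespace cubicCurve

section theta

variable {L : Type*} [Field L]

lemma line_relations {a b c x₁ y₁ x₂ y₂ s : L} (e₁ : y₁ ^ 2 = x₁ ^ 3 + a * x₁ ^ 2 + b * x₁ + c)
    (e₂ : y₂ ^ 2 = x₂ ^ 3 + a * x₂ ^ 2 + b * x₂ + c)
    (hs : x₁ ≠ x₂ ∧ s * (x₁ - x₂) = y₁ - y₂ ∨
      x₁ = x₂ ∧ y₁ = y₂ ∧ 2 * y₁ ≠ 0 ∧ s * (2 * y₁) = 3 * x₁ ^ 2 + 2 * a * x₁ + b) :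
    y₂ = y₁ + s * (x₂ - x₁) ∧
    x₁ * x₂ + x₁ * (s ^ 2 - a - x₁ - x₂) + x₂ * (s ^ 2 - a - x₁ - x₂) =
      b - 2 * s * (y₁ - s * x₁) ∧
    x₁ * x₂ * (s ^ 2 - a - x₁ - x₂) = (y₁ - s * x₁) ^ 2 - c := by
  have h2 : x₁ * x₂ + x₁ * (s ^ 2 - a - x₁ - x₂) + x₂ * (s ^ 2 - a - x₁ - x₂) =
      b - 2 * s * (y₁ - s * x₁) := by
    rcases hs with ⟨hx, hs⟩ | ⟨rfl, rfl, -, hs⟩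
    · apply mul_left_cancel₀ (sub_ne_zero.mpr hx)
      linear_combination e₁ - e₂ + (s * (x₁ + x₂) + 2 * (y₁ - s * x₁) - (y₁ - y₂)) * hs
    · linear_combination hs
  refine ⟨?_, h2, ?_⟩
  · rcases hs with ⟨-, hs⟩ | ⟨rfl, rfl, -, hs⟩
    · linear_combination hs
    · ring
  · linear_combination x₁ * h2 - e₁

/-- The function `y u(x)` is additive up to the `p`-th power of the slope. -/
lemma theta_add (p : ℕ) [Fact p.Prime] [CharP L p] {a b c k x₁ y₁ x₂ y₂ s : L} {u : L[X]}
    (hu : u.Monic) (hdeg : 2 * u.natDegree + 3 = p)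
    (hode : 2 * (X ^ 3 + C a * X ^ 2 + C b * X + C c) * derivative u +
        (3 * X ^ 2 + 2 * C a * X + C b) * u = C k)
    (e₁ : y₁ ^ 2 = x₁ ^ 3 + a * x₁ ^ 2 + b * x₁ + c)
    (e₂ : y₂ ^ 2 = x₂ ^ 3 + a * x₂ ^ 2 + b * x₂ + c)
    (hs : x₁ ≠ x₂ ∧ s * (x₁ - x₂) = y₁ - y₂ ∨
      x₁ = x₂ ∧ y₁ = y₂ ∧ 2 * y₁ ≠ 0 ∧ s * (2 * y₁) = 3 * x₁ ^ 2 + 2 * a * x₁ + b) :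
    -(y₁ + s * (s ^ 2 - a - x₁ - x₂ - x₁)) * u.eval (s ^ 2 - a - x₁ - x₂) =
      y₁ * u.eval x₁ + y₂ * u.eval x₂ - s ^ p := by
  obtain ⟨h0, h2, h3⟩ := line_relations e₁ e₂ hs
  have := sum_line_mul_eval p (l := s) (n := y₁ - s * x₁) hu hdeg hode
    (x₁ := x₁) (x₂ := x₂) (x₃ := s ^ 2 - a - x₁ - x₂) (by ring) h2 h3
  rw [h0]
  linear_combination -this

end theta

section derivation

variable {L : Type*} [Field L] (D : Derivation ℤ L L)

/-- The invariant derivation is compatible with addition of points. -/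
lemma derivation_add {a b c x₁ y₁ x₂ y₂ s m : L} (ha : D a = 0) (hb : D b = 0)
    (e₁ : y₁ ^ 2 = x₁ ^ 3 + a * x₁ ^ 2 + b * x₁ + c)
    (e₂ : y₂ ^ 2 = x₂ ^ 3 + a * x₂ ^ 2 + b * x₂ + c)
    {δ : L} (hx₁ : D x₁ = m * (2 * y₁ * δ)) (hy₁ : D y₁ = m * ((3 * x₁ ^ 2 + 2 * a * x₁ + b) * δ))
    (hx₂ : D x₂ = 2 * y₂ * δ) (hy₂ : D y₂ = (3 * x₂ ^ 2 + 2 * a * x₂ + b) * δ)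
    (hm : x₁ = x₂ → m = 1)
    (hs : x₁ ≠ x₂ ∧ s * (x₁ - x₂) = y₁ - y₂ ∨
      x₁ = x₂ ∧ y₁ = y₂ ∧ 2 * y₁ ≠ 0 ∧ s * (2 * y₁) = 3 * x₁ ^ 2 + 2 * a * x₁ + b)  :
    D s = (m * x₁ + x₂ - (m + 1) * (s ^ 2 - a - x₁ - x₂)) * δ ∧
    D (s ^ 2 - a - x₁ - x₂) =
      (m + 1) * (2 * (-(y₁ + s * (s ^ 2 - a - x₁ - x₂ - x₁))) * δ) ∧
    D (-(y₁ + s * (s ^ 2 - a - x₁ - x₂ - x₁))) = (m + 1) *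
      ((3 * (s ^ 2 - a - x₁ - x₂) ^ 2 + 2 * a * (s ^ 2 - a - x₁ - x₂) + b) * δ) := by
  obtain ⟨h0, h2, h3⟩ := line_relations e₁ e₂ hs
  have hD2 : D 2 = 0 := D.map_natCast 2
  have hD3 : D 3 = 0 := D.map_natCast 3
  have hs' : D s = (m * x₁ + x₂ - (m + 1) * (s ^ 2 - a - x₁ - x₂)) * δ := by
    rcases hs with ⟨hx, hs⟩ | ⟨hx, hy, hy0, hs⟩
    · have := congrArg D hs
      simp only [Derivation.leibniz, map_sub, smul_eq_mul, hx₁, hx₂, hy₁, hy₂] at this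
      apply mul_left_cancel₀ (sub_ne_zero.mpr hx)
      subst h0
      linear_combination this + (1 - m) * δ * h2
    · obtain rfl := hm hx
      subst hx hy
      have := congrArg D hs
      simp only [Derivation.leibniz, map_add, smul_eq_mul, hx₁, hy₁, Derivation.leibniz_pow,
        hD2, hD3, ha, hb, nsmul_eq_mul] at this
      push_cast at this
      apply mul_left_cancel₀ hy0
      linear_combination this + 2 * δ * s * hs
  have hx' : D (s ^ 2 - a - x₁ - x₂) =
      (m + 1) * (2 * (-(y₁ + s * (s ^ 2 - a - x₁ - x₂ - x₁))) * δ) := by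
    simp only [map_sub, Derivation.leibniz_pow, hs', ha, hx₁, hx₂, smul_eq_mul, nsmul_eq_mul]
    push_cast
    subst h0
    ring
  refine ⟨hs', hx', ?_⟩
  have : D (s ^ 2 - a - x₁ - x₂ - x₁) = D (s ^ 2 - a - x₁ - x₂) - D x₁ := map_sub _ _ _
  rw [map_neg, map_add, Derivation.leibniz, this, hx', hs', hx₁, hy₁]
  simp only [smul_eq_mul]
  subst h0
  linear_combination (2 * m + 1) * δ * h2

end derivation
end cubicCurve

namespace cubicCurve

open TensorProduct in
lemma exists_derivation_of_formallyEtale (K L : Type*) [Field K] [Field L] [Algebra K L]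
    [Algebra K[X] L] [IsScalarTower K K[X] L] [Algebra.FormallyEtale K[X] L] :
    ∃ D : Derivation K L L, D (algebraMap K[X] L X) = 1 := by
  let d : Derivation K K[X] L := Derivation.mk'
    ((IsScalarTower.toAlgHom K K[X] L).toLinearMap ∘ₗ derivative) fun q r => by
      simp [Algebra.smul_def]; ring
  let e := KaehlerDifferential.tensorKaehlerEquivOfFormallyEtale K K[X] L
  let φ : Ω[L⁄K] →ₗ[L] L := (LinearMap.liftBaseChange L d.liftKaehlerDifferential) ∘ₗ
    e.symm.toLinearMap
  refine ⟨φ.compDer (KaehlerDifferential.D K L), ?_⟩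
  have := KaehlerDifferential.tensorKaehlerEquivOfFormallyEtale_symm_D_algebraMap K K[X] L X
  change φ (KaehlerDifferential.D K L (algebraMap K[X] L X)) = 1
  simp only [φ, e, LinearMap.comp_apply, LinearEquiv.coe_coe]
  rw [this]
  simp [d]

/-- A separably closed extension with a derivation trivial on the constants. -/
theorem exists_derivation (K : Type) [Field K] : ∃ (L : Type) (_ : Field L) (_ : Algebra K L)
    (D : Derivation K L L) (x : L), IsSepClosed L ∧ D x = 1 ∧ ∀ q : K[X], aeval x q = 0 → q = 0 := by
  let M := RatFunc K
  let L := SeparableClosure M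
  have e1 : Algebra.FormallyEtale K[X] M := .of_isLocalization (nonZeroDivisors K[X])
  have e2 : Algebra.FormallyEtale M L := .of_isSeparable M L
  have e3 : Algebra.FormallyEtale K[X] L := .comp K[X] M L
  let a : Algebra K L := ((algebraMap K[X] L).comp C).toAlgebra
  have : IsScalarTower K K[X] L := .of_algebraMap_eq fun r => rfl
  obtain ⟨D, hD⟩ := exists_derivation_of_formallyEtale K L
  refine ⟨L, inferInstance, a, D, algebraMap K[X] L X, inferInstance, hD, fun q hq => ?_⟩
  rw [← IsScalarTower.toAlgHom_apply K K[X] L, aeval_algHom_apply, aeval_X_left_apply,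
    IsScalarTower.toAlgHom_apply, IsScalarTower.algebraMap_apply K[X] M L] at hq
  exact RatFunc.algebraMap_injective K (by simpa using hq)

end cubicCurve

namespace cubicCurve

open WeierstrassCurve.Affine

theorem exists_nsmul_eq {L : Type*} [Field L] [DecidableEq L] (p : ℕ) [Fact p.Prime] [CharP L p]
    (D : Derivation ℤ L L) {a b c κ : L} {u : L[X]} (hu : u.Monic) (hdeg : 2 * u.natDegree + 3 = p)
    (hode : 2 * (X ^ 3 + C a * X ^ 2 + C b * X + C c) * derivative u +
        (3 * X ^ 2 + 2 * C a * X + C b) * u = C κ)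
    (ha : D a = 0) (hb : D b = 0) {x y δ : L} (hQ : (cubicCurve a b c).Nonsingular x y)
    (hy0 : 2 * y ≠ 0) (hx : D x = 2 * y * δ) (hy : D y = (3 * x ^ 2 + 2 * a * x + b) * δ)
    (hne : ∀ k : ℕ, k ≠ 0 → k • Point.some x y hQ ≠ 0) (k : ℕ) :
    ∃ x' y' h s, (k + 1) • Point.some x y hQ = Point.some x' y' h ∧
      D x' = ((k + 1 : ℕ) : L) * (2 * y' * δ) ∧
      D y' = ((k + 1 : ℕ) : L) * ((3 * x' ^ 2 + 2 * a * x' + b) * δ) ∧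
      D s = ((k + 1 : ℕ) : L) * ((x - x') * δ) ∧
      y' * u.eval x' = ((k + 1 : ℕ) : L) * (y * u.eval x) - s ^ p := by
  have hp0 : p ≠ 0 := (Fact.out : p.Prime).ne_zero
  induction k with
  | zero =>
    refine ⟨x, y, hQ, 0, by simp, by simp [hx], by simp [hy], by simp, by simp [hp0]⟩
  | succ k ih =>
    obtain ⟨x₁, y₁, h₁, s₁, hk, dx, dy, ds, hθ⟩ := ih
    have e₁ := equation_of_nonsingular h₁
    have e₂ := equation_of_nonsingular hQ
    have hk1 : x₁ = x → k = 0 ∧ y₁ = y := by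
      rintro rfl
      have : (y₁ - y) * (y₁ + y) = 0 := by linear_combination e₁ - e₂
      rcases mul_eq_zero.mp this with h | h
      · obtain rfl := sub_eq_zero.mp h
        refine ⟨?_, rfl⟩
        by_contra hk0
        refine hne k hk0 ?_
        rw [succ_nsmul] at hk
        simpa using hk
      · exfalso
        refine hne (k + 1 + 1) (by omega) ?_
        rw [succ_nsmul, hk]
        exact add_eq_zero_of h₁ hQ (by linear_combination h)
    obtain ⟨s, hs⟩ : ∃ s, x₁ ≠ x ∧ s * (x₁ - x) = y₁ - y ∨
        x₁ = x ∧ y₁ = y ∧ 2 * y₁ ≠ 0 ∧ s * (2 * y₁) = 3 * x₁ ^ 2 + 2 * a * x₁ + b := by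
      by_cases hx' : x₁ = x
      · refine ⟨(3 * x₁ ^ 2 + 2 * a * x₁ + b) / (2 * y₁), .inr ⟨hx', (hk1 hx').2, ?_, ?_⟩⟩
        · rw [(hk1 hx').2]; exact hy0
        · exact div_mul_cancel₀ _ (by rw [(hk1 hx').2]; exact hy0)
      · exact ⟨(y₁ - y) / (x₁ - x), .inl ⟨hx', div_mul_cancel₀ _ (sub_ne_zero.mpr hx')⟩⟩
    obtain ⟨h₃, hadd⟩ := add_of_slope h₁ hQ hs
    obtain ⟨d1, d2, d3⟩ := derivation_add D ha hb e₁ e₂ dx dy hx hy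
      (fun h => by rw [(hk1 h).1]; simp) hs
    refine ⟨_, _, h₃, s₁ + s, ?_, ?_, ?_, ?_, ?_⟩
    · rw [succ_nsmul, hk, hadd]
    · rw [d2]; push_cast; ring
    · rw [d3]; push_cast; ring
    · rw [map_add, ds, d1]; push_cast; ring
    · rw [theta_add p hu hdeg hode e₁ e₂ hs, hθ, add_pow_char]; push_cast; ring

lemma exists_map_frobenius_eq {K : Type*} [Field K] [IsAlgClosed K] (p : ℕ)
    [Fact p.Prime] [CharP K p] (q : K[X]) : ∃ r : K[X], r.map (frobenius K p) = q :=
  Polynomial.map_surjective _ (surjective_frobenius K p) q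

lemma exists_eq_pow_of_derivative_eq_zero {K : Type*} [Field K] [IsAlgClosed K] (p : ℕ)
    [Fact p.Prime] [CharP K p] {q : K[X]} (hq : derivative q = 0) : ∃ r : K[X], q = r ^ p := by
  obtain ⟨r, hr⟩ := exists_map_frobenius_eq p (contract p q)
  refine ⟨r, ?_⟩
  rw [← map_frobenius_expand (R := K) p, map_expand, hr, expand_contract' p hq]

lemma exists_eq_pow_of_derivation_eq_zero {K L : Type*} [Field K] [IsAlgClosed K] (p : ℕ)
    [Fact p.Prime] [CharP K p] [Field L] [Algebra K L] (D : Derivation K L L) {x : L}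
    (hx : D x = 1) (hinj : ∀ q : K[X], aeval x q = 0 → q = 0) {N E : K[X]} (hNE : IsCoprime N E)
    {X' : L} (hE : aeval x N = X' * aeval x E) (hX : D X' = 0) :
    ∃ N' E', N = N' ^ p ∧ E = E' ^ p := by
  have h := congrArg D hE
  rw [Derivation.leibniz, hX, Derivation.map_aeval, Derivation.map_aeval, hx] at h
  simp only [smul_eq_mul, mul_one, mul_zero, add_zero] at h
  have hw : wronskian N E = 0 := by
    apply hinj
    rw [wronskian, map_sub, map_mul, map_mul, h, hE]
    ring
  obtain ⟨h1, h2⟩ := hNE.wronskian_eq_zero_iff.mp hw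
  obtain ⟨N', rfl⟩ := exists_eq_pow_of_derivative_eq_zero p h1
  obtain ⟨E', rfl⟩ := exists_eq_pow_of_derivative_eq_zero p h2
  exact ⟨N', E', rfl, rfl⟩

lemma aeval_pow_map_frobenius {K L : Type*} [Field K] (p : ℕ) [Fact p.Prime] [CharP K p] [Field L]
    [CharP L p] [Algebra K L] (x : L) (q : K[X]) :
    aeval (x ^ p) (q.map (frobenius K p)) = aeval x q ^ p := by
  rw [← expand_aeval, ← map_expand, map_frobenius_expand, map_pow]

lemma mem_range_of_aeval_eq_zero {K L : Type*} [Field K] [IsAlgClosed K] [Field L] [Algebra K L]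
    {x : L} {q : K[X]} (hq : q ≠ 0) (h : aeval x q = 0) : x ∈ (algebraMap K L).range := by
  have hint : IsIntegral K x := isAlgebraic_iff_isIntegral.mp ⟨q, hq, h⟩
  exact minpoly.mem_range_of_degree_eq_one K x
    (IsAlgClosed.degree_eq_one_of_irreducible K (minpoly.irreducible hint))

/-- If the Hasse invariant vanishes, multiplication by `p` acts on `x`-coordinates as the
`p ^ 2`-power Frobenius followed by an affine map. -/
theorem exists_nsmul_eq_frobenius {K : Type} [Field K] [IsAlgClosed K] [DecidableEq K] (p : ℕ)
    [Fact p.Prime] [CharP K p] (hp : 5 ≤ p) {a b c : K}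
    (hsep : ∀ x : K, x ^ 3 + a * x ^ 2 + b * x + c = 0 → 3 * x ^ 2 + 2 * a * x + b ≠ 0)
    (hH : ((X ^ 3 + C a * X ^ 2 + C b * X + C c) ^ ((p - 1) / 2) : K[X]).coeff (p - 1) = 0) :
    ∃ A B : K, ∀ x y h x' y' h', p • (Point.some x y h : (cubicCurve a b c).Point) =
      Point.some x' y' h' → x' = A * x ^ p ^ 2 + B := by
  have hp0 : p ≠ 0 := by omega
  have h2 : (2 : K) ≠ 0 := fun h => by
    have := Nat.le_of_dvd two_pos ((CharP.cast_eq_zero_iff K p 2).mp (by exact_mod_cast h))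
    omega
  obtain ⟨u, κ, hu, hdeg, hode⟩ := exists_of_hasse p a b c hp hH
  have hκ := hasse_const_ne_zero p hsep hu hdeg hode
  obtain ⟨N, E, hNE⟩ := exists_mulFormula h2 hsep p
  obtain ⟨L, _, _, D, x, hL, hDx, hinj⟩ := exists_derivation K
  classical
  have : CharP L p := charP_of_injective_algebraMap (algebraMap K L).injective p
  have h2L : (2 : L) ≠ 0 := by
    rw [← map_ofNat (algebraMap K L) 2]; exact (_root_.map_ne_zero _).mpr h2
  let i := algebraMap K L
  have hDi : ∀ r, D (i r) = 0 := D.map_algebraMap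
  obtain ⟨y, hy⟩ : ∃ y, x ^ 3 + i a * x ^ 2 + i b * x + i c = y * y := by
    have : NeZero (2 : L) := ⟨h2L⟩
    exact IsSepClosed.exists_eq_mul_self _
  have hf0 : (X ^ 3 + C a * X ^ 2 + C b * X + C c : K[X]) ≠ 0 :=
    Monic.ne_zero (by monicity!)
  have hy0 : y ≠ 0 := by
    rintro rfl
    refine hf0 (hinj _ ?_)
    simpa using hy
  have hQ : (cubicCurve (i a) (i b) (i c)).Nonsingular x y :=
    nonsingular_iff.mpr ⟨by rw [hy]; ring, .inr (mul_ne_zero h2L hy0)⟩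
  have hDy : D y = (3 * x ^ 2 + 2 * i a * x + i b) * (2 * y)⁻¹ := by
    have h := congrArg D hy
    simp only [map_add, Derivation.leibniz, Derivation.leibniz_pow, hDi, hDx, smul_eq_mul,
      nsmul_eq_mul] at h
    push_cast at h
    field_simp
    linear_combination -h
  have hne : ∀ k : ℕ, k ≠ 0 → k • Point.some x y hQ ≠ 0 := by
    intro k hk h0
    obtain ⟨M, G, hMG⟩ := exists_mulFormula h2 hsep k
    have hr := hMG.xRep L x y hQ
    rw [h0, xRep_zero] at hr
    have hG := hinj _ hr.1
    have hc := hMG.isCoprime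
    rw [hG, isCoprime_zero_right] at hc
    have hd := natDegree_eq_zero_of_isUnit hc
    rw [hMG.natDegree_num] at hd
    exact hk (by simpa using hd)
  have hdeg' : 2 * (u.map i).natDegree + 3 = p := by rw [natDegree_map]; exact hdeg
  have hode' := congrArg (Polynomial.map i) hode
  simp only [Polynomial.map_add, Polynomial.map_mul, Polynomial.map_pow, map_X, map_C,
    Polynomial.map_ofNat, ← derivative_map] at hode'
  obtain ⟨x', y', h', s, hk, dx, -, ds, hθ⟩ := exists_nsmul_eq p (D.restrictScalars ℤ)
    (hu.map i) hdeg' hode' (hDi a) (hDi b) hQ (mul_ne_zero h2L hy0) (δ := (2 * y)⁻¹)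
    (by rw [mul_inv_cancel₀ (mul_ne_zero h2L hy0)]; exact hDx) hDy hne (p - 1)
  rw [show p - 1 + 1 = p by omega] at hk dx ds hθ
  rw [CharP.cast_eq_zero, zero_mul] at dx ds hθ
  change D x' = 0 at dx
  change D s = 0 at ds
  have hr := hNE.xRep L x y hQ
  rw [hk, xRep_some] at hr
  obtain ⟨N₁, E₁, rfl, rfl⟩ := exists_eq_pow_of_derivation_eq_zero p D hDx hinj hNE.isCoprime
    hr.2 dx
  have hN0 : ∀ e, N₁ ^ p ≠ C e * E₁ ^ p := by
    intro e he
    have hd := hNE.natDegree_num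
    rw [he] at hd
    have h1 := natDegree_C_mul_le e (E₁ ^ p)
    rcases hNE.natDegree_den with h | h
    · rw [h] at hd; simp at hd; exact hp0 (pow_eq_zero_iff two_ne_zero |>.mp hd.symm)
    · omega
  have hc₁ : IsCoprime N₁ E₁ := (IsCoprime.pow_iff (by omega) (by omega)).mp hNE.isCoprime
  have hE₁ : aeval x E₁ ≠ 0 := fun h => hr.1 (by rw [map_pow, h, zero_pow hp0])
  obtain ⟨X', hX'⟩ : ∃ X', aeval x N₁ = X' * aeval x E₁ :=
    ⟨aeval x N₁ / aeval x E₁, (div_mul_cancel₀ _ hE₁).symm⟩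
  have hXp : X' ^ p = x' := by
    have := hr.2
    rw [map_pow, map_pow, hX', mul_pow] at this
    exact mul_right_cancel₀ (pow_ne_zero p hE₁) this
  have hux : aeval x' u ≠ 0 := by
    intro h
    obtain ⟨e, rfl⟩ := mem_range_of_aeval_eq_zero hu.ne_zero h
    refine hN0 e (sub_eq_zero.mp (hinj _ ?_))
    rw [map_sub, hr.2, map_mul, aeval_C, sub_self]
  have dX : D X' = 0 := by
    obtain ⟨T, hT⟩ := exists_map_frobenius_eq p ((X ^ 3 + C a * X ^ 2 + C b * X + C c) * u ^ 2)
    have h1 : aeval X' T = s ^ 2 := by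
      apply frobenius_inj L p
      rw [frobenius_def, frobenius_def, ← aeval_pow_map_frobenius, hT, hXp]
      have e' := equation_of_nonsingular h'
      rw [eval_map_algebraMap] at hθ
      simp only [map_mul, map_add, map_pow, aeval_X, aeval_C]
      rw [← e', ← mul_pow, hθ]
      ring
    have h2 := congrArg D h1
    rw [Derivation.map_aeval, Derivation.leibniz_pow, ds, smul_zero, smul_zero, smul_eq_mul] at h2
    refine (mul_eq_zero.mp h2).resolve_left fun h3 => ?_
    have h4 : (derivative T).map (frobenius K p) = u * C κ := by
      rw [← derivative_map, hT, ← hode]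
      simp only [derivative_mul, derivative_pow, derivative_add, derivative_X, derivative_C]
      simp [map_ofNat C]
      ring
    have h5 := aeval_pow_map_frobenius p X' (derivative T)
    rw [h3, h4, hXp, zero_pow hp0, map_mul, aeval_C] at h5
    exact (mul_ne_zero hux ((_root_.map_ne_zero _).mpr hκ)) h5
  obtain ⟨N₂, E₂, rfl, rfl⟩ := exists_eq_pow_of_derivation_eq_zero p D hDx hinj hc₁ hX' dX
  have hd1 : N₂.natDegree = 1 := by
    have := hNE.natDegree_num
    rw [natDegree_pow, natDegree_pow, ← mul_assoc, ← sq] at this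
    exact Nat.eq_of_mul_eq_mul_left (pow_pos (by omega) 2) (this.trans (mul_one _).symm)
  have hd2 : E₂.natDegree = 0 := by
    rcases hNE.natDegree_den with h | h
    · rw [pow_eq_zero_iff hp0, pow_eq_zero_iff hp0] at h
      rw [h, natDegree_zero]
    · rw [natDegree_pow, natDegree_pow, ← mul_assoc, ← sq] at h
      by_contra h0
      nlinarith [Nat.pos_of_ne_zero h0, pow_pos (show 0 < p by omega) 2]
  obtain ⟨α, -, β, rfl⟩ := natDegree_eq_one.mp hd1
  obtain ⟨e, rfl⟩ := natDegree_eq_zero.mp hd2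
  refine ⟨(α / e) ^ p ^ 2, (β / e) ^ p ^ 2, fun x y h x' y' h' hpQ => ?_⟩
  have hr := hNE.xRep K x y h
  simp only [Algebra.algebraMap_self, RingHom.id_apply] at hr
  rw [hpQ] at hr
  rw [hr.ratio]
  simp only [map_pow, map_add, map_mul, aeval_C, aeval_X, Algebra.algebraMap_self,
    RingHom.id_apply]
  rw [← pow_mul, ← pow_mul, ← sq, ← div_pow, add_div, add_pow_char_pow, mul_div_right_comm, mul_pow]

end cubicCurve

lemma coeff_X_sq_add_C_pow {R : Type*} [CommRing R] (c : R) (i : ℕ) :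
    ((X ^ 2 + C c : R[X]) ^ i).coeff i =
      if 2 ∣ i then (i.choose (i / 2) : R) * c ^ (i / 2) else 0 := by
  have : (X ^ 2 + C c : R[X]) ^ i = expand R 2 ((X + C c) ^ i) := by simp
  rw [this, coeff_expand two_pos]
  split_ifs with h
  · rw [coeff_X_add_C_pow, mul_comm]
    congr 2
    omega
  · rfl

/-- Two expansions of the central coefficient of `((t + z) (t + z + w)) ^ N`. -/
lemma sum_choose_mul_choose {R : Type*} [CommRing R] (N : ℕ) (z w : R) :
    ∑ k ∈ Finset.range (N + 1), (N.choose k : R) * ((N + k).choose k : R) * w ^ (N - k) * z ^ k =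
      ∑ j ∈ Finset.range (N / 2 + 1), (N.choose (2 * j) : R) * ((2 * j).choose j : R) *
        (z * (z + w)) ^ j * (2 * z + w) ^ (N - 2 * j) := by
  have e1 : (((X + C z) * (X + C z + C w)) ^ N : R[X]).coeff N =
      ∑ k ∈ Finset.range (N + 1),
        (N.choose k : R) * ((N + k).choose k : R) * w ^ (N - k) * z ^ k := by
    rw [mul_pow, add_pow (X + C z) (C w), Finset.mul_sum, finsetSum_coeff]
    refine Finset.sum_congr rfl fun k _ => ?_
    rw [show (X + C z : R[X]) ^ N * ((X + C z) ^ k * C w ^ (N - k) * (N.choose k : R[X])) =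
      C (w ^ (N - k) * (N.choose k : R)) * (X + C z) ^ (N + k) by
        rw [C_mul, C_pow, pow_add, C_eq_natCast]; ring, coeff_C_mul, coeff_X_add_C_pow,
      Nat.add_sub_cancel_left, Nat.choose_symm_add]
    ring
  have e2 : (((X + C z) * (X + C z + C w)) ^ N : R[X]).coeff N =
      ∑ i ∈ Finset.range (N + 1), if 2 ∣ i then (N.choose i : R) * (i.choose (i / 2) : R) *
        (z * (z + w)) ^ (i / 2) * (2 * z + w) ^ (N - i) else 0 := by
    rw [show ((X + C z) * (X + C z + C w) : R[X]) =
      (X ^ 2 + C (z * (z + w))) + C (2 * z + w) * X by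
        simp only [map_add, map_mul, map_ofNat C]; ring, add_pow, finsetSum_coeff]
    refine Finset.sum_congr rfl fun i hi => ?_
    have hi' : i ≤ N := Nat.lt_succ_iff.mp (Finset.mem_range.mp hi)
    rw [show (X ^ 2 + C (z * (z + w)) : R[X]) ^ i * (C (2 * z + w) * X) ^ (N - i) *
        (N.choose i : R[X]) = C ((2 * z + w) ^ (N - i) * (N.choose i : R)) *
          ((X ^ 2 + C (z * (z + w))) ^ i * X ^ (N - i)) by
        rw [C_mul (a := (2 * z + w) ^ (N - i)), C_pow, mul_pow, C_eq_natCast]; ring, coeff_C_mul, coeff_mul_X_pow',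
      if_pos (Nat.sub_le _ _), Nat.sub_sub_self hi', coeff_X_sq_add_C_pow]
    split_ifs <;> ring
  rw [← e1, e2, ← Finset.sum_filter]
  symm
  refine Finset.sum_bij (fun j _ => 2 * j) ?_ ?_ ?_ ?_
  · intro j hj
    simp only [Finset.mem_range, Finset.mem_filter] at hj ⊢
    exact ⟨by omega, dvd_mul_right 2 j⟩
  · intro j _ j' _ h
    simpa using h
  · intro i hi
    simp only [Finset.mem_range, Finset.mem_filter] at hi
    obtain ⟨h1, j, rfl⟩ := hi
    exact ⟨j, by simp only [Finset.mem_range]; omega, rfl⟩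
  · intro j _
    rw [Nat.mul_div_cancel_left j two_pos]

lemma coeff_cubic_pow {R : Type*} [CommRing R] (m : ℕ) (e g : R) :
    ((X ^ 3 + C e * X ^ 2 + C g : R[X]) ^ m).coeff (2 * m) =
      ∑ k ∈ Finset.range (m + 1), (m.choose k : R) * ((m - k).choose (2 * k) : R) *
        g ^ k * e ^ (m - 3 * k) := by
  rw [show (X ^ 3 + C e * X ^ 2 + C g : R[X]) = C g + X ^ 2 * (X + C e) by ring, add_pow,
    finsetSum_coeff]
  refine Finset.sum_congr rfl fun k hk => ?_
  have hk' : k ≤ m := Nat.lt_succ_iff.mp (Finset.mem_range.mp hk)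
  rw [show (C g : R[X]) ^ k * (X ^ 2 * (X + C e)) ^ (m - k) * (m.choose k : R[X]) =
      C (g ^ k * (m.choose k : R)) * ((X + C e) ^ (m - k) * X ^ (2 * (m - k))) by
        rw [C_mul, C_pow, mul_pow, C_eq_natCast, pow_mul]; ring, coeff_C_mul, coeff_mul_X_pow',
    if_pos (by omega), coeff_X_add_C_pow, show 2 * m - 2 * (m - k) = 2 * k by omega,
    show m - k - 2 * k = m - 3 * k by omega]
  ring

lemma choose_mul_choose_succ (m k : ℕ) (h : 3 * (k + 1) ≤ m) :
    m.choose (k + 1) * (m - (k + 1)).choose (2 * (k + 1)) *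
        ((k + 1) * (2 * k + 1) * (2 * k + 2)) =
      m.choose k * (m - k).choose (2 * k) * ((m - 3 * k) * (m - 3 * k - 1) * (m - 3 * k - 2)) := by
  obtain ⟨j, rfl⟩ := Nat.exists_eq_add_of_le h
  have f : ∀ i j : ℕ, (3 * i + j).choose i * (2 * i + j).choose (2 * i) *
      (i.factorial * (2 * i).factorial * j.factorial) = (3 * i + j).factorial := fun i j => by
    have h1 := Nat.add_choose_mul_factorial_mul_factorial (2 * i + j) i
    have h2 := Nat.add_choose_mul_factorial_mul_factorial j (2 * i)
    rw [show 2 * i + j + i = 3 * i + j by ring] at h1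
    rw [add_comm j] at h2
    rw [← h1, ← h2]
    ring
  have f1 := f (k + 1) j
  have f2 := f k (j + 3)
  rw [show 3 * k + (j + 3) = 3 * (k + 1) + j by ring, ← f1] at f2
  rw [show 3 * (k + 1) + j - (k + 1) = 2 * (k + 1) + j by omega,
    show 3 * (k + 1) + j - k = 2 * k + (j + 3) by omega,
    show 3 * (k + 1) + j - 3 * k = j + 3 by omega, show j + 3 - 1 = j + 2 by omega,
    show j + 3 - 2 = j + 1 by omega]
  have hpos : 0 < k.factorial * (2 * k).factorial * j.factorial := by positivity
  apply Nat.eq_of_mul_eq_mul_right hpos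
  rw [show 2 * (k + 1) = 2 * k + 1 + 1 by ring] at *
  simp only [Nat.factorial_succ] at f2
  linarith

lemma choose_mul_choose_add_succ (N k : ℕ) :
    N.choose (k + 1) * (N + (k + 1)).choose (k + 1) * (k + 1) ^ 2 =
      N.choose k * (N + k).choose k * ((N - k) * (N + k + 1)) := by
  have h1 := Nat.choose_succ_right_eq N k
  have h2 := Nat.add_one_mul_choose_eq (N + k) k
  rw [← add_assoc]
  calc _ = (N.choose (k + 1) * (k + 1)) * ((N + k + 1).choose (k + 1) * (k + 1)) := by ring
    _ = _ := by rw [h1, ← h2]; ring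

/-- The coefficient computing the Hasse invariant of `y² = x³ + 3 α x² + 4 z`. -/
theorem coeff_cubic_pow_eq {K : Type*} [Field K] (p : ℕ) [Fact p.Prime] [CharP K p] (hp : 5 ≤ p)
    (α z : K) : ((X ^ 3 + C (3 * α) * X ^ 2 + C (4 * z) : K[X]) ^ ((p - 1) / 2)).coeff (p - 1) =
      3 ^ ((p - 1) / 2) * α ^ (if p % 3 = 2 then 2 else 0) *
        ∑ j ∈ Finset.range (p / 6 / 2 + 1), ((p / 6).choose (2 * j) : K) * ((2 * j).choose j : K) *
        (z * (z + α ^ 3)) ^ j * (2 * z + α ^ 3) ^ (p / 6 - 2 * j) := by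
  have hpp : p.Prime := Fact.out
  have h2 : p % 2 = 1 := hpp.eq_two_or_odd.resolve_left (by omega)
  have h3 : p % 3 ≠ 0 := fun h => by
    have := (Nat.prime_dvd_prime_iff_eq Nat.prime_three hpp).mp (Nat.dvd_of_mod_eq_zero h)
    omega
  set N := p / 6 with hN
  set m := (p - 1) / 2 with hm
  set e := if p % 3 = 2 then 2 else 0 with he
  have hme : m = 3 * N + e := by
    rw [he]; split_ifs <;> omega
  have hpm : p = 2 * m + 1 := by omega
  have hNK : (6 * N + 1 : K) * (6 * N + 5) = 0 := by
    have h0 : p = 6 * N + 1 ∨ p = 6 * N + 5 := by omega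
    have hp0 : (p : K) = 0 := CharP.cast_eq_zero K p
    rcases h0 with h | h <;> rw [h] at hp0 <;> push_cast at hp0 <;> rw [hp0] <;> simp
  have hcast : ∀ i : ℕ, 0 < i → i < p → (i : K) ≠ 0 := fun i h0 hi h => by
    have := Nat.le_of_dvd h0 ((CharP.cast_eq_zero_iff K p i).mp h)
    omega
  have key : ∀ k, k ≤ N → (m.choose k : K) * ((m - k).choose (2 * k) : K) * 4 ^ k =
      27 ^ k * ((N.choose k : K) * ((N + k).choose k : K)) := by
    intro k
    induction k with
    | zero => simp
    | succ k ih =>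
      intro hk
      have i1 := ih (by omega)
      have a1 := congrArg (Nat.cast (R := K)) (choose_mul_choose_succ m k (by omega))
      have a2 := congrArg (Nat.cast (R := K)) (choose_mul_choose_add_succ N k)
      push_cast [Nat.cast_sub (show k ≤ N by omega), Nat.cast_sub (show 3 * k ≤ m by omega),
        Nat.cast_sub (show 1 ≤ m - 3 * k by omega),
        Nat.cast_sub (show 2 ≤ m - 3 * k by omega)] at a1 a2
      have hm2 : (2 * m + 1 : K) = 0 := by
        have hp0 : (p : K) = 0 := CharP.cast_eq_zero K p
        rw [hpm] at hp0
        exact_mod_cast hp0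
      have hk0 : ((k + 1 : ℕ) : K) * ((2 * k + 1 : ℕ) : K) * ((2 * k + 2 : ℕ) : K) * ((8 : ℕ) : K)
          ≠ 0 := by
        have h2K := hcast 2 (by omega) (by omega)
        have h8 : ((8 : ℕ) : K) = ((2 : ℕ) : K) ^ 3 := by norm_num
        rw [h8]
        exact mul_ne_zero (mul_ne_zero (mul_ne_zero (hcast _ (by omega) (by omega))
          (hcast _ (by omega) (by omega))) (hcast _ (by omega) (by omega))) (pow_ne_zero _ h2K)
      push_cast at hk0
      apply mul_left_cancel₀ hk0
      have a1' : (m.choose (k + 1) : K) * ((m - (k + 1)).choose (2 * (k + 1)) : K) *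
          ((k + 1) * (2 * k + 1) * (2 * k + 2)) * 8 =
          -((m.choose k : K) * ((m - k).choose (2 * k) : K) *
            ((6 * k + 1) * (6 * k + 3) * (6 * k + 5))) := by
        obtain ⟨M, hM⟩ : ∃ M : K, (m : K) = M := ⟨_, rfl⟩
        rw [a1, hM]
        rw [hM] at hm2
        linear_combination (m.choose k : K) * ((m - k).choose (2 * k) : K) *
          ((4 * M ^ 2 - 36 * M * k + 108 * k ^ 2 - 14 * M + 90 * k + 15)) * hm2
      linear_combination 4 ^ (k + 1) * a1' - 4 * ((6 * k + 1) * (6 * k + 3) * (6 * k + 5)) * i1 -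
        27 ^ (k + 1) * (16 * (2 * k + 1)) * a2 -
        27 ^ k * ((N.choose k : K) * ((N + k).choose k : K)) * (12 * (2 * k + 1)) * hNK
  rw [show p - 1 = 2 * m by omega, coeff_cubic_pow, ← sum_choose_mul_choose, Finset.mul_sum]
  symm
  refine Finset.sum_subset_zero_on_sdiff ?_ ?_ ?_
  · intro k
    simp only [Finset.mem_range]
    omega
  · intro k hk
    simp only [Finset.mem_sdiff, Finset.mem_range] at hk
    have : e ≤ 2 := by rw [he]; split_ifs <;> omega
    rw [Nat.choose_eq_zero_of_lt (show m - k < 2 * k by omega)]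
    simp
  · intro k hk
    simp only [Finset.mem_range] at hk
    have hkey := key k (by omega)
    rw [mul_pow 4, mul_pow 3, show m - 3 * k = e + 3 * (N - k) by omega]
    have h3m : (3 : K) ^ m = 3 ^ (e + 3 * (N - k)) * 27 ^ k := by
      rw [show (27 : K) = 3 ^ 3 by norm_num, ← pow_mul, ← pow_add]
      congr 1
      omega
    rw [h3m, pow_add α, pow_mul α]
    linear_combination -(3 ^ (e + 3 * (N - k)) * z ^ k * α ^ e * (α ^ 3) ^ (N - k)) * hkey

lemma nsmul_of_seven_torsion {G : Type*} [AddCommGroup G] {P Q R : G} (h₁ : P + P = Q)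
    (h₂ : P + Q = R) (h₃ : Q + Q = -R) {p : ℕ} (hp : ¬ 7 ∣ p) :
    ((p • P = P ∨ p • P = -P) ∧ (p • Q = Q ∨ p • Q = -Q) ∧ (p • R = R ∨ p • R = -R)) ∨
    ((p • P = Q ∨ p • P = -Q) ∧ (p • Q = R ∨ p • Q = -R) ∧ (p • R = P ∨ p • R = -P)) ∨
    ((p • P = R ∨ p • P = -R) ∧ (p • Q = P ∨ p • Q = -P) ∧ (p • R = Q ∨ p • R = -Q)) := by
  subst h₁ h₂
  have h7 : (7 : ℤ) • P = 0 := by linear_combination (norm := module) h₃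
  obtain ⟨q, r, hr, rfl⟩ : ∃ q r, r < 7 ∧ p = 7 * q + r :=
    ⟨p / 7, p % 7, Nat.mod_lt _ (by norm_num), (Nat.div_add_mod p 7).symm⟩
  have hP : ((7 * q + r : ℕ) : ℤ) • P = (r : ℤ) • P := by
    push_cast
    linear_combination (norm := module) (q : ℤ) • h7
  simp only [smul_add, ← natCast_zsmul, hP]
  interval_cases r
  · omega
  · left
    refine ⟨.inl ?_, .inl ?_, .inl ?_⟩ <;> push_cast <;> module
  · right; left
    refine ⟨.inl ?_, .inr ?_, .inr ?_⟩ <;> push_cast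
    · module
    · linear_combination (norm := module) h7
    · linear_combination (norm := module) h7
  · right; right
    refine ⟨.inl ?_, .inr ?_, .inl ?_⟩ <;> push_cast
    · module
    · linear_combination (norm := module) h7
    · linear_combination (norm := module) h7
  · right; right
    refine ⟨.inr ?_, .inl ?_, .inr ?_⟩ <;> push_cast
    · linear_combination (norm := module) h7
    · linear_combination (norm := module) h7
    · linear_combination (norm := module) (2 : ℤ) • h7
  · right; left
    refine ⟨.inr ?_, .inl ?_, .inl ?_⟩ <;> push_cast
    · linear_combination (norm := module) h7
    · linear_combination (norm := module) h7
    · linear_combination (norm := module) (2 : ℤ) • h7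
  · left
    refine ⟨.inr ?_, .inr ?_, .inr ?_⟩ <;> push_cast
    · linear_combination (norm := module) h7
    · linear_combination (norm := module) (2 : ℤ) • h7
    · linear_combination (norm := module) (3 : ℤ) • h7

namespace cubicCurve

open WeierstrassCurve.Affine

lemma add_eq_some {F : Type*} [Field F] [DecidableEq F] {a b c x₁ x₂ x₃ y₁ y₂ y₃ : F} (s : F)
    {h₁ : (cubicCurve a b c).Nonsingular x₁ y₁} {h₂ : (cubicCurve a b c).Nonsingular x₂ y₂}
    (h₃ : (cubicCurve a b c).Nonsingular x₃ y₃)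
    (hs : x₁ ≠ x₂ ∧ s * (x₁ - x₂) = y₁ - y₂ ∨
      x₁ = x₂ ∧ y₁ = y₂ ∧ 2 * y₁ ≠ 0 ∧ s * (2 * y₁) = 3 * x₁ ^ 2 + 2 * a * x₁ + b)
    (hx : x₃ = s ^ 2 - a - x₁ - x₂) (hy : y₃ = -(y₁ + s * (x₃ - x₁))) :
    Point.some x₁ y₁ h₁ + Point.some x₂ y₂ h₂ = Point.some x₃ y₃ h₃ := by
  obtain ⟨_, h⟩ := add_of_slope h₁ h₂ hs
  subst hx hy
  exact h

/-- A short Weierstrass form of the Tate normal form `E₇` acquires a subgroup of order `7`. -/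
theorem exists_seven_torsion {F : Type*} [Field F] [DecidableEq F] {d r α z : F}
    (h2 : (2 : F) ≠ 0) (h3 : (3 : F) ≠ 0) (hd0 : d ≠ 0) (hd1 : d ≠ 1) (hr : r ^ 2 = 3)
    (hα : α ^ 2 = (d ^ 2 - d + 1) *
      (d ^ 6 - 11 * d ^ 5 + 30 * d ^ 4 - 15 * d ^ 3 - 10 * d ^ 2 + 5 * d + 1))
    (hz : 2 * z + α ^ 3 = d ^ 12 - 18 * d ^ 11 + 117 * d ^ 10 - 354 * d ^ 9 + 570 * d ^ 8 -
      486 * d ^ 7 + 273 * d ^ 6 - 222 * d ^ 5 + 174 * d ^ 4 - 46 * d ^ 3 - 15 * d ^ 2 + 6 * d + 1) :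
    ∃ e y₁ y₂ y₃ h₁ h₂ h₃,
      let P : (cubicCurve (3 * α) 0 (4 * z)).Point := Point.some e y₁ h₁
      let Q : (cubicCurve (3 * α) 0 (4 * z)).Point := Point.some (e + 12 * (d ^ 3 - d ^ 2)) y₂ h₂
      let R : (cubicCurve (3 * α) 0 (4 * z)).Point := Point.some (e + 12 * (d ^ 2 - d)) y₃ h₃
      P + P = Q ∧ P + Q = R ∧ Q + Q = -R := by
  have hr0 : r ≠ 0 := by rintro rfl; exact h3 (by rw [← hr]; ring)
  have hd1' : d - 1 ≠ 0 := sub_ne_zero.mpr hd1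
  have h12 : (12 : F) ≠ 0 := by
    have : (12 : F) = 2 * 2 * 3 := by norm_num
    rw [this]
    simp [h2, h3]
  obtain ⟨c, hc⟩ : ∃ c, c = d ^ 2 - d := ⟨_, rfl⟩
  obtain ⟨b, hb⟩ : ∃ b, b = d * c := ⟨_, rfl⟩
  have hbd : d ^ 3 - d ^ 2 = b := by rw [hb, hc]; ring
  have hc0 : c ≠ 0 := by
    rw [hc, show d ^ 2 - d = d * (d - 1) by ring]; exact mul_ne_zero hd0 hd1'
  have hb0 : b ≠ 0 := hb ▸ mul_ne_zero hd0 hc0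
  have hbc : b - c ≠ 0 := by
    rw [hb, show d * c - c = (d - 1) * c by ring]; exact mul_ne_zero hd1' hc0
  rw [hbd, ← hc]
  obtain ⟨e, he⟩ : ∃ e, e = (1 - c) ^ 2 - 4 * b - α := ⟨_, rfl⟩
  have h₁ : (cubicCurve (3 * α) 0 (4 * z)).Nonsingular e (12 * r * (-b)) := by
    refine nonsingular_iff.mpr ⟨?_, .inr ?_⟩
    · rw [he, hb, hc]
      linear_combination 144 * (d * (d ^ 2 - d)) ^ 2 * hr +
        3 * ((1 - (d ^ 2 - d)) ^ 2 - 4 * (d * (d ^ 2 - d))) * hα - 2 * hz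
    · exact mul_ne_zero h2 (mul_ne_zero (mul_ne_zero h12 hr0) (neg_ne_zero.mpr hb0))
  have h₂ : (cubicCurve (3 * α) 0 (4 * z)).Nonsingular (e + 12 * b) (12 * r * (b * c)) := by
    refine nonsingular_iff.mpr ⟨?_, .inr ?_⟩
    · rw [he, hb, hc]
      linear_combination 144 * ((d * (d ^ 2 - d)) * (d ^ 2 - d)) ^ 2 * hr +
        3 * (((1 - (d ^ 2 - d)) ^ 2 - 4 * (d * (d ^ 2 - d))) + 12 * (d * (d ^ 2 - d))) * hα - 2 * hz
    · exact mul_ne_zero h2 (mul_ne_zero (mul_ne_zero h12 hr0) (mul_ne_zero hb0 hc0))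
  have hy₃ : b - c - c ^ 2 ≠ 0 := by
    rw [hb, show d * c - c - c ^ 2 = - c * (d - 1) ^ 2 by rw [hc]; ring]
    exact mul_ne_zero (neg_ne_zero.mpr hc0) (pow_ne_zero 2 hd1')
  have h₃ : (cubicCurve (3 * α) 0 (4 * z)).Nonsingular (e + 12 * c)
      (12 * r * (b - c - c ^ 2)) := by
    refine nonsingular_iff.mpr ⟨?_, .inr ?_⟩
    · rw [he, hb, hc]
      linear_combination 144 * ((d * (d ^ 2 - d)) - (d ^ 2 - d) - (d ^ 2 - d) ^ 2) ^ 2 * hr +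
        3 * (((1 - (d ^ 2 - d)) ^ 2 - 4 * (d * (d ^ 2 - d))) + 12 * (d ^ 2 - d)) * hα - 2 * hz
    · exact mul_ne_zero h2 (mul_ne_zero (mul_ne_zero h12 hr0) hy₃)
  refine ⟨e, _, _, _, h₁, h₂, h₃, ?_, ?_, ?_⟩
  · refine add_eq_some (r * (1 - c)) h₂ (.inr ⟨rfl, rfl, ?_, ?_⟩) ?_ ?_
    · exact mul_ne_zero h2 (mul_ne_zero (mul_ne_zero h12 hr0) (neg_ne_zero.mpr hb0))
    · rw [he, hb, hc]
      linear_combination -24 * (1 - (d ^ 2 - d)) * (d * (d ^ 2 - d)) * hr + 3 * hα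
    · rw [he]
      linear_combination -(1 - c) ^ 2 * hr
    · ring
  · refine add_eq_some (r * (1 + c)) h₃ (.inl ⟨?_, ?_⟩) ?_ ?_
    · intro h
      exact mul_ne_zero h12 hb0 (by linear_combination -h)
    · ring
    · rw [he]
      linear_combination -(1 + c) ^ 2 * hr
    · ring
  · obtain ⟨h₃', h⟩ := neg_some h₃
    rw [h]
    refine add_eq_some (r * (2 * (d ^ 2 - 1) + 1 - c)) h₃' (.inr ⟨rfl, rfl, ?_, ?_⟩) ?_ ?_
    · exact mul_ne_zero h2 (mul_ne_zero (mul_ne_zero h12 hr0) (mul_ne_zero hb0 hc0))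
    · rw [he, hb, hc]
      linear_combination 24 * (2 * (d ^ 2 - 1) + 1 - (d ^ 2 - d)) * (d * (d ^ 2 - d)) * (d ^ 2 - d) * hr +
        3 * hα
    · rw [he, hb, hc]
      linear_combination -(2 * (d ^ 2 - 1) + 1 - (d ^ 2 - d)) ^ 2 * hr
    · rw [hb, hc]
      ring

end cubicCurve

namespace cubicCurve

open WeierstrassCurve.Affine

theorem pow_sq_of_supersingular {K : Type} [Field K] [IsAlgClosed K] (p : ℕ) [Fact p.Prime]
    [CharP K p] (hp : 5 ≤ p) (hp7 : p ≠ 7) {d r α z : K}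
    (hd0 : d ≠ 0) (hd1 : d ≠ 1) (hr : r ^ 2 = 3)
    (hα : α ^ 2 = (d ^ 2 - d + 1) *
      (d ^ 6 - 11 * d ^ 5 + 30 * d ^ 4 - 15 * d ^ 3 - 10 * d ^ 2 + 5 * d + 1))
    (hz : 2 * z + α ^ 3 = d ^ 12 - 18 * d ^ 11 + 117 * d ^ 10 - 354 * d ^ 9 + 570 * d ^ 8 -
      486 * d ^ 7 + 273 * d ^ 6 - 222 * d ^ 5 + 174 * d ^ 4 - 46 * d ^ 3 - 15 * d ^ 2 + 6 * d + 1)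
    (hΔ : z * (z + α ^ 3) ≠ 0)
    (hH : ((X ^ 3 + C (3 * α) * X ^ 2 + C (4 * z)) ^ ((p - 1) / 2) : K[X]).coeff (p - 1) = 0) :
    d ^ p ^ 2 = d ∨ d ^ p ^ 2 * (1 - d) = 1 ∨ d ^ p ^ 2 * d = d - 1 := by
  classical
  have hp' : p.Prime := Fact.out
  have hlt : ∀ q : ℕ, q < 5 → q ≠ 0 → (q : K) ≠ 0 := fun q hq hq0 h =>
    absurd (Nat.le_of_dvd (Nat.pos_of_ne_zero hq0) ((CharP.cast_eq_zero_iff K p q).mp h)) (by omega)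
  have h2 : (2 : K) ≠ 0 := by simpa using hlt 2 (by norm_num) (by norm_num)
  have h3 : (3 : K) ≠ 0 := by simpa using hlt 3 (by norm_num) (by norm_num)
  have h12 : (12 : K) ≠ 0 := by
    have : (12 : K) = 2 * 2 * 3 := by norm_num
    rw [this]
    simp [h2, h3]
  have h7 : ¬ 7 ∣ p := fun h => hp7 ((Nat.prime_dvd_prime_iff_eq (by norm_num) hp').mp h).symm
  have hc0 : d ^ 2 - d ≠ 0 := by
    rw [show d ^ 2 - d = d * (d - 1) by ring]
    exact mul_ne_zero hd0 (sub_ne_zero.mpr hd1)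
  obtain ⟨e, y₁, y₂, y₃, h₁, h₂, h₃, hPP, hPQ, hQQ⟩ := exists_seven_torsion h2 h3 hd0 hd1 hr hα hz
  obtain ⟨A, B, hAB⟩ := exists_nsmul_eq_frobenius (K := K) p hp (a := 3 * α) (b := 0) (c := 4 * z)
    (by
      intro x hx hx'
      have : x * (x + 2 * α) = 0 := by
        apply mul_left_cancel₀ h3
        linear_combination hx'
      apply hΔ
      rcases mul_eq_zero.mp this with h | h
      · have : 2 * 2 * z = 0 := by rw [h] at hx; linear_combination hx
        simp_all
      · have h' : x = -(2 * α) := by linear_combination h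
        have : 2 * 2 * (z + α ^ 3) = 0 := by rw [h'] at hx; linear_combination hx
        simp_all)
    (by simpa using hH)
  have key : ∀ {x y h x' y' h'}, (p • (Point.some x y h : (cubicCurve (3 * α) 0 (4 * z)).Point) =
      Point.some x' y' h' ∨ p • (Point.some x y h : (cubicCurve (3 * α) 0 (4 * z)).Point) =
      -Point.some x' y' h') → x' = A * x ^ p ^ 2 + B := by
    intro x y h x' y' h' hh
    rcases hh with hh | hh
    · exact hAB _ _ _ _ _ _ hh
    · obtain ⟨_, hneg⟩ := neg_some h'
      exact hAB _ _ _ _ _ _ (hh.trans hneg)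
  have hσ : ∀ t : K, (e + 12 * t) ^ p ^ 2 = e ^ p ^ 2 + 12 * t ^ p ^ 2 := fun t => by
    simp only [← iterateFrobenius_def, map_add, map_mul, map_ofNat]
  have hdc : (d ^ 3 - d ^ 2) ^ p ^ 2 = d ^ p ^ 2 * (d ^ 2 - d) ^ p ^ 2 := by
    rw [← mul_pow]; ring
  rcases nsmul_of_seven_torsion hPP hPQ hQQ h7 with ⟨k₁, k₂, k₃⟩ | ⟨k₁, k₂, k₃⟩ | ⟨k₁, k₂, k₃⟩ <;>
    replace k₁ := key k₁ <;> replace k₂ := key k₂ <;> replace k₃ := key k₃ <;>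
    rw [hσ] at k₂ k₃ <;> rw [hdc] at k₂ <;>
    generalize d ^ p ^ 2 = d' at k₁ k₂ k₃ ⊢ <;>
    generalize (d ^ 2 - d) ^ p ^ 2 = c' at k₁ k₂ k₃
  · left
    apply mul_left_cancel₀ (mul_ne_zero h12 hc0)
    linear_combination d' * (k₃ - k₁) - (k₂ - k₁)
  · right; right
    apply mul_left_cancel₀ (mul_ne_zero h12 hc0)
    linear_combination -d' * (k₃ - k₁) + (k₂ - k₁)
  · right; left
    apply mul_left_cancel₀ (mul_ne_zero h12 hc0)
    linear_combination -d' * (k₃ - k₁) + (k₂ - k₁)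

end cubicCurve

lemma choose_sum_eq {K : Type*} [CommRing K] (n s : ℕ) (hs : s ≤ 1) {c D w : K}
    (hw : w = -432 * D) :
    c ^ s * ∑ k ∈ Finset.range (n + 1), ((2 * n + s).choose (2 * k + s) : K) *
      ((2 * n - 2 * k).choose (n - k) : K) * (-432) ^ (n - k) * (c ^ 2) ^ k * D ^ (n - k) =
    ∑ j ∈ Finset.range ((2 * n + s) / 2 + 1), ((2 * n + s).choose (2 * j) : K) *
      ((2 * j).choose j : K) * w ^ j * c ^ (2 * n + s - 2 * j) := by
  rw [show (2 * n + s) / 2 = n by omega, ← Finset.sum_range_reflect, Finset.mul_sum]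
  refine Finset.sum_congr rfl fun j hj => ?_
  have hj' : j ≤ n := by simpa [Nat.lt_succ_iff] using hj
  rw [show n + 1 - 1 - j = n - j by omega, show n - (n - j) = j by omega,
    show 2 * n - 2 * (n - j) = 2 * j by omega,
    show (2 * n + s).choose (2 * (n - j) + s) = (2 * n + s).choose (2 * j) from
      Nat.choose_symm_of_eq_add (by omega),
    show 2 * n + s - 2 * j = s + 2 * (n - j) by omega, hw, mul_pow, pow_add, pow_mul]
  ring

lemma aeval_H7 {K : Type*} [Field K] (l : ℕ) [Algebra (ZMod l) K] {d A B c D : K}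
    (hA : A = d ^ 2 - d + 1)
    (hB : B = d ^ 6 - 11 * d ^ 5 + 30 * d ^ 4 - 15 * d ^ 3 - 10 * d ^ 2 + 5 * d + 1)
    (hc : c = d ^ 12 - 18 * d ^ 11 + 117 * d ^ 10 - 354 * d ^ 9 + 570 * d ^ 8 -
      486 * d ^ 7 + 273 * d ^ 6 - 222 * d ^ 5 + 174 * d ^ 4 - 46 * d ^ 3 - 15 * d ^ 2 + 6 * d + 1)
    (hD : D = d ^ 7 * (d - 1) ^ 7 * (d ^ 3 - 8 * d ^ 2 + 5 * d + 1)) :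
    aeval d (H7 l) = (A * B) ^ (if l % 3 = 2 then 1 else 0) *
      (c ^ (if l % 4 = 3 then 1 else 0) * ∑ k ∈ Finset.range (l / 12 + 1),
        ((2 * (l / 12) + (if l % 4 = 3 then 1 else 0)).choose
          (2 * k + (if l % 4 = 3 then 1 else 0)) : K) *
        ((2 * (l / 12) - 2 * k).choose (l / 12 - k) : K) * (-432) ^ (l / 12 - k) *
        (c ^ 2) ^ k * D ^ (l / 12 - k)) := by
  have hc2 : c ^ 2 = A ^ 3 * B ^ 3 - 1728 * D := by
    rw [hA, hB, hc, hD]; ring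
  rw [hc2]
  simp only [H7, map_mul, map_sum, map_pow, map_sub, map_add, map_neg, map_ofNat, map_natCast,
    map_one, aeval_X, ← hA, ← hB, ← hc, ← hD]
  ring

theorem H7_root_ne {K : Type*} [Field K] (l : ℕ) [Fact l.Prime] [Algebra (ZMod l) K]
    (h7 : l ≠ 7) {d : K} (hd : aeval d (H7 l) = 0) :
    d ^ 7 * (d - 1) ^ 7 * (d ^ 3 - 8 * d ^ 2 + 5 * d + 1) ≠ 0 := by
  intro hD
  obtain ⟨A, hA⟩ : ∃ A, A = d ^ 2 - d + 1 := ⟨_, rfl⟩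
  obtain ⟨B, hB⟩ : ∃ B, B = d ^ 6 - 11 * d ^ 5 + 30 * d ^ 4 - 15 * d ^ 3 - 10 * d ^ 2 + 5 * d + 1 :=
    ⟨_, rfl⟩
  obtain ⟨c, hc⟩ : ∃ c, c = d ^ 12 - 18 * d ^ 11 + 117 * d ^ 10 - 354 * d ^ 9 + 570 * d ^ 8 -
    486 * d ^ 7 + 273 * d ^ 6 - 222 * d ^ 5 + 174 * d ^ 4 - 46 * d ^ 3 - 15 * d ^ 2 + 6 * d + 1 :=
    ⟨_, rfl⟩
  have hc2 : c ^ 2 = (A * B) ^ 3 := by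
    rw [hA, hB, hc]; linear_combination (-1728) * hD
  have h7' : (7 : K) ≠ 0 := by
    have : CharP K l := charP_of_injective_algebraMap (algebraMap (ZMod l) K).injective l
    intro h
    have := (CharP.cast_eq_zero_iff K l 7).mp (by exact_mod_cast h)
    exact h7 ((Nat.prime_dvd_prime_iff_eq Fact.out (by norm_num)).mp this)
  have hAB : A * B ≠ 0 := by
    rcases mul_eq_zero.mp hD with h | h
    · rcases mul_eq_zero.mp h with h | h
      · have h : d = 0 := eq_zero_of_pow_eq_zero h
        simp [hA, hB, h]
      · have h : d = 1 := sub_eq_zero.mp (eq_zero_of_pow_eq_zero h)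
        norm_num [hA, hB, h]
    · refine mul_ne_zero (fun hA0 => ?_) (fun hB0 => ?_)
      · apply pow_ne_zero 2 h7'
        rw [hA] at hA0
        linear_combination (44 + 16 * d - 3 * d ^ 2) * hA0 + (5 + 3 * d) * h
      · apply one_ne_zero (α := K)
        rw [hB] at hB0
        linear_combination (37 + 46 * d - 7 * d ^ 2) * hB0 +
          (-36 - 51 * d + 114 * d ^ 2 + 108 * d ^ 3 - 67 * d ^ 4 + 7 * d ^ 5) * h
  have hc0 : c ≠ 0 := by
    rintro rfl
    exact pow_ne_zero 3 hAB (by rw [← hc2]; ring)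
  rw [aeval_H7 l hA hB hc hD.symm, Finset.sum_range_succ, Finset.sum_eq_zero] at hd
  · refine mul_ne_zero (pow_ne_zero _ hAB) (mul_ne_zero (pow_ne_zero _ hc0) ?_) hd
    simp [hc0]
  · intro k hk
    rw [zero_pow, mul_zero]
    simp at hk
    omega

theorem pow_sq_of_aeval_H7_eq_zero {K : Type} [Field K] [IsAlgClosed K] (l : ℕ) [Fact l.Prime]
    [Algebra (ZMod l) K] (h2 : l ≠ 2) (h3 : l ≠ 3) (h7 : l ≠ 7) {d : K}
    (hd : aeval d (H7 l) = 0) :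
    d ≠ 0 ∧ d ≠ 1 ∧ (d ^ l ^ 2 = d ∨ d ^ l ^ 2 * (1 - d) = 1 ∨ d ^ l ^ 2 * d = d - 1) := by
  have hD := H7_root_ne l h7 hd
  have hd0 : d ≠ 0 := by rintro rfl; simp at hD
  have hd1 : d ≠ 1 := by rintro rfl; simp at hD
  refine ⟨hd0, hd1, ?_⟩
  have : CharP K l := charP_of_injective_algebraMap (algebraMap (ZMod l) K).injective l
  have hl : l.Prime := Fact.out
  have hl2 : l % 2 = 1 := hl.eq_two_or_odd.resolve_left h2
  have hl3 : l % 3 ≠ 0 := fun h => h3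
    ((Nat.prime_dvd_prime_iff_eq Nat.prime_three hl).mp (Nat.dvd_of_mod_eq_zero h)).symm
  have hl5 : 5 ≤ l := by have := hl.two_le; omega
  have hlt : ∀ q : ℕ, q < 5 → q ≠ 0 → (q : K) ≠ 0 := fun q hq hq0 h =>
    absurd (Nat.le_of_dvd (Nat.pos_of_ne_zero hq0) ((CharP.cast_eq_zero_iff K l q).mp h)) (by omega)
  have h2' : (2 : K) ≠ 0 := by simpa using hlt 2 (by norm_num) (by norm_num)
  have h3' : (3 : K) ≠ 0 := by simpa using hlt 3 (by norm_num) (by norm_num)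
  obtain ⟨A, hA⟩ : ∃ A, A = d ^ 2 - d + 1 := ⟨_, rfl⟩
  obtain ⟨B, hB⟩ : ∃ B, B = d ^ 6 - 11 * d ^ 5 + 30 * d ^ 4 - 15 * d ^ 3 - 10 * d ^ 2 + 5 * d + 1 :=
    ⟨_, rfl⟩
  obtain ⟨c, hc⟩ : ∃ c, c = d ^ 12 - 18 * d ^ 11 + 117 * d ^ 10 - 354 * d ^ 9 + 570 * d ^ 8 -
    486 * d ^ 7 + 273 * d ^ 6 - 222 * d ^ 5 + 174 * d ^ 4 - 46 * d ^ 3 - 15 * d ^ 2 + 6 * d + 1 :=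
    ⟨_, rfl⟩
  obtain ⟨D, hD'⟩ : ∃ D, D = d ^ 7 * (d - 1) ^ 7 * (d ^ 3 - 8 * d ^ 2 + 5 * d + 1) := ⟨_, rfl⟩
  obtain ⟨r, hr⟩ := IsAlgClosed.exists_pow_nat_eq (3 : K) (n := 2) (by norm_num)
  obtain ⟨α, hα⟩ := IsAlgClosed.exists_pow_nat_eq (A * B) (n := 2) (by norm_num)
  obtain ⟨z, hz⟩ : ∃ z, 2 * z + α ^ 3 = c := ⟨(c - α ^ 3) / 2, by field_simp; ring⟩
  have hc2 : c ^ 2 = (A * B) ^ 3 - 1728 * D := by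
    rw [hA, hB, hc, hD']; ring
  have hzz : z * (z + α ^ 3) = -432 * D := by
    apply mul_left_cancel₀ (mul_ne_zero h2' h2')
    rw [← hz, ← hα] at hc2
    linear_combination hc2
  refine cubicCurve.pow_sq_of_supersingular l hl5 h7 hd0 hd1 hr (hα.trans (by rw [hA, hB]))
    (hz.trans hc) ?_ ?_
  · rw [hzz, hD', show (-432 : K) = -(2 ^ 4 * 3 ^ 3) by norm_num]
    exact mul_ne_zero (neg_ne_zero.mpr (mul_ne_zero (pow_ne_zero _ h2') (pow_ne_zero _ h3'))) hD
  · have hl6 : l / 6 = 2 * (l / 12) + (if l % 4 = 3 then 1 else 0) := by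
      have : l % 12 = 1 ∨ l % 12 = 5 ∨ l % 12 = 7 ∨ l % 12 = 11 := by omega
      split_ifs <;> omega
    have hαr : α ^ (if l % 3 = 2 then 2 else 0) = (A * B) ^ (if l % 3 = 2 then 1 else 0) := by
      split_ifs <;> simp [hα]
    rw [coeff_cubic_pow_eq l hl5, hαr, hz, hl6,
      ← choose_sum_eq _ _ (by split_ifs <;> norm_num) hzz, mul_assoc,
      ← aeval_H7 l hA hB hc hD', hd, mul_zero]

lemma mem_range_of_pow_natCard_eq {E K : Type*} [Field E] [Finite E] [Field K] (σ : E →+* K)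
    {x : K} (hx : x ^ Nat.card E = x) : ∃ y, σ y = x := by
  classical
  have := Fintype.ofFinite E
  rw [Nat.card_eq_fintype_card] at hx
  by_contra! hne
  apply FiniteField.X_pow_card_sub_X_ne_zero K (Fintype.one_lt_card (α := E))
  refine eq_zero_of_natDegree_lt_card_of_eval_eq_zero' _ (insert x (Finset.univ.image σ)) ?_ ?_
  · intro i hi
    rw [Finset.mem_insert, Finset.mem_image] at hi
    rcases hi with rfl | ⟨e, -, rfl⟩
    · simp [hx]
    · simp [← map_pow, FiniteField.pow_card]
  · rw [FiniteField.X_pow_card_sub_X_natDegree_eq K Fintype.one_lt_card,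
      Finset.card_insert_of_notMem (by simpa using fun e => hne e),
      Finset.card_image_of_injective _ σ.injective, Finset.card_univ]
    exact Nat.lt_succ_self _

lemma aeval_pow_prime_pow_eq_zero {K : Type*} [Field K] {l : ℕ} [Fact l.Prime]
    [Algebra (ZMod l) K] {f : (ZMod l)[X]} {d : K} (hd : aeval d f = 0) (k : ℕ) :
    aeval (d ^ l ^ k) f = 0 := by
  induction k with
  | zero => simpa using hd
  | succ k ih => rw [pow_succ, pow_mul, ← expand_aeval, ZMod.expand_card, map_pow, ih,
      zero_pow (Fact.out : l.Prime).ne_zero]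

lemma pow_prime_pow_eq_self_iff {K : Type*} [Field K] {l : ℕ} [Fact l.Prime]
    [Algebra (ZMod l) K] {f : (ZMod l)[X]} (hirr : Irreducible f) {d : K} (hd : aeval d f = 0)
    (k : ℕ) : d ^ l ^ k = d ↔ f.natDegree ∣ k := by
  rw [hirr.natDegree_dvd_iff_dvd_X_pow_card_pow_sub_X, ← hirr.dvd_iff_aeval_eq_zero hd,
    Nat.card_zmod]
  simp [sub_eq_zero]

/-- The simplest cubic polynomial with parameter `a`. -/
noncomputable def simplestCubic {R : Type*} [CommRing R] (a : R) : R[X] :=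
  X ^ 3 + C a * X ^ 2 - C (a + 3) * X + 1

lemma simplestCubic_natDegree {R : Type*} [CommRing R] [Nontrivial R] (a : R) :
    (simplestCubic a).natDegree = 3 := by
  unfold simplestCubic; compute_degree!

lemma simplestCubic_monic {R : Type*} [CommRing R] [Nontrivial R] (a : R) :
    (simplestCubic a).Monic := by
  have h := simplestCubic_natDegree a
  rw [Monic, leadingCoeff, h]
  simp [simplestCubic, coeff_one]

lemma simplestCubic_map {R S : Type*} [CommRing R] [CommRing S] (σ : R →+* S) (a : R) :
    (simplestCubic a).map σ = simplestCubic (σ a) := by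
  simp [simplestCubic, map_ofNat σ]

section

variable {K : Type*} [Field K] {l : ℕ} [Fact l.Prime] [Algebra (ZMod l) K] {d : K}

lemma orbit_of_pow_sq (hd1 : d ≠ 1) (h : d ^ l ^ 2 * (1 - d) = 1 ∨ d ^ l ^ 2 * d = d - 1) :
    (d ^ l ^ 2 = -(d - 1)⁻¹ ∨ d ^ l ^ 4 = -(d - 1)⁻¹) ∧
      d ^ 3 - (d + d ^ l ^ 2 + d ^ l ^ 4) * d ^ 2 - (-(d + d ^ l ^ 2 + d ^ l ^ 4) + 3) * d + 1 =
        0 := by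
  have : CharP K l := charP_of_injective_algebraMap (algebraMap (ZMod l) K).injective l
  have hd1' : d - 1 ≠ 0 := sub_ne_zero.mpr hd1
  obtain ⟨v, hv⟩ : ∃ v, d ^ l ^ 2 = v := ⟨_, rfl⟩
  obtain ⟨w, hw⟩ : ∃ w, d ^ l ^ 4 = w := ⟨_, rfl⟩
  have hvw : v ^ l ^ 2 = w := by
    rw [← hv, ← hw, ← pow_mul, ← pow_add]
  have hσ : ∀ x, x ^ l ^ 2 = iterateFrobenius K l 2 x := fun x => by rw [iterateFrobenius_def]
  rw [hv, hw]
  rw [hv] at h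
  rw [hσ] at hv hvw
  rcases h with h | h
  · have hw' : w * (1 - v) = 1 := by
      simpa [hv, hvw] using congrArg (iterateFrobenius K l 2) h
    have hvd : v = -(d - 1)⁻¹ := by
      field_simp
      linear_combination -h
    have hwd : w * d = d - 1 := by linear_combination (d - 1) * hw' - w * h
    exact ⟨.inl hvd, by linear_combination d * h - (d - 1) * hwd⟩
  · have hw' : w * v = v - 1 := by
      simpa [hv, hvw] using congrArg (iterateFrobenius K l 2) h
    have hwd : w * (1 - d) = 1 := by linear_combination -d * hw' + (w - 1) * h
    refine ⟨.inr ?_, by linear_combination d * hwd - (d - 1) * h⟩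
    field_simp
    linear_combination -hwd

end

theorem exists_simplestCubic_eq {l : ℕ} [Fact l.Prime] {K : Type*} [Field K] [Algebra (ZMod l) K]
    {f : (ZMod l)[X]} (hmonic : f.Monic) (hirr : Irreducible f) (h3 : f.natDegree = 3) {d a : K}
    (hd : aeval d f = 0) (ha : a = -(d + d ^ l ^ 2 + d ^ l ^ 4))
    (hroot : aeval d (simplestCubic a) = 0) : ∃ b : ZMod l, f = simplestCubic b := by
  have : CharP K l := charP_of_injective_algebraMap (algebraMap (ZMod l) K).injective l
  have hd3 : d ^ l ^ 3 = d := (pow_prime_pow_eq_self_iff hirr hd 3).mpr (by simp [h3])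
  have hd4 : d ^ l ^ 4 = d ^ l := by rw [pow_succ, pow_mul, hd3]
  have hal : a ^ l = a := by
    rw [hd4] at ha
    rw [← frobenius_def, ha]
    simp only [map_neg, map_add, frobenius_def, ← pow_mul, ← pow_succ, hd3, ← pow_two]
    ring
  obtain ⟨b, rfl⟩ := mem_range_of_pow_natCard_eq (algebraMap (ZMod l) K) (x := a) (by simpa)
  refine ⟨b, (eq_of_monic_of_dvd_of_natDegree_le hmonic (simplestCubic_monic b) ?_ ?_).symm⟩
  · refine (hirr.dvd_iff_aeval_eq_zero hd).mp ?_
    rwa [← aeval_map_algebraMap (R := ZMod l) K, simplestCubic_map]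
  · rw [simplestCubic_natDegree, h3]

theorem exists_map_eq_simplestCubic_mul {l : ℕ} [Fact l.Prime] {K : Type*} [Field K] [IsAlgClosed K]
    [Algebra (ZMod l) K] {f : (ZMod l)[X]} (hmonic : f.Monic) (hirr : Irreducible f)
    (h6 : f.natDegree = 6) {d a : K} (hd : aeval d f = 0)
    (ha : a = -(d + d ^ l ^ 2 + d ^ l ^ 4)) (hroot : aeval d (simplestCubic a) = 0) :
    ∃ b : GaloisField l 2, f.map (algebraMap (ZMod l) (GaloisField l 2)) =
      simplestCubic b * simplestCubic (b ^ l) := by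
  have : CharP K l := charP_of_injective_algebraMap (algebraMap (ZMod l) K).injective l
  have hd6 : d ^ l ^ 6 = d := (pow_prime_pow_eq_self_iff hirr hd 6).mpr (by simp [h6])
  have hcard : Nat.card (GaloisField l 2) = l ^ 2 := GaloisField.card l 2 two_ne_zero
  have hal : a ^ l ^ 2 = a := by
    rw [← iterateFrobenius_def, ha]
    simp only [map_neg, map_add, iterateFrobenius_def, ← pow_mul, ← pow_add, Nat.reduceAdd, hd6]
    ring
  let ι : GaloisField l 2 →ₐ[ZMod l] K := IsAlgClosed.lift
  obtain ⟨b, rfl⟩ := mem_range_of_pow_natCard_eq (ι : GaloisField l 2 →+* K) (x := a)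
    (by rwa [hcard])
  refine ⟨b, ?_⟩
  have hbl : (b ^ l) ^ l = b := by
    rw [← pow_mul, ← pow_two, ← hcard]
    have := Fintype.ofFinite (GaloisField l 2)
    rw [Nat.card_eq_fintype_card, FiniteField.pow_card]
  obtain ⟨G, hG⟩ : ∃ G, G = simplestCubic b * simplestCubic (b ^ l) := ⟨_, rfl⟩
  have hGm : G.Monic := hG ▸ (simplestCubic_monic _).mul (simplestCubic_monic _)
  have hGdeg : G.natDegree = 6 := by
    rw [hG, (simplestCubic_monic b).natDegree_mul (simplestCubic_monic _),
      simplestCubic_natDegree, simplestCubic_natDegree]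
  have hGfrob : G.map (frobenius (GaloisField l 2) l) = G := by
    rw [hG, Polynomial.map_mul, simplestCubic_map, simplestCubic_map, frobenius_def, frobenius_def,
      hbl, mul_comm]
  have hlift : G ∈ lifts (algebraMap (ZMod l) (GaloisField l 2)) := by
    refine (lifts_iff_coeff_lifts _).mpr fun n => ?_
    refine mem_range_of_pow_natCard_eq _ ?_
    rw [Nat.card_zmod, ← frobenius_def, ← coeff_map, hGfrob]
  obtain ⟨g, hg, hgdeg, hgm⟩ := lifts_and_natDegree_eq_and_monic hlift hGm
  have hfg : g = f := by
    refine eq_of_monic_of_dvd_of_natDegree_le hmonic hgm ?_ (by rw [hgdeg, hGdeg, h6])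
    rw [← hirr.dvd_iff_aeval_eq_zero hd, ← aeval_map_algebraMap (R := ZMod l) K]
    have hmap : g.map (algebraMap (ZMod l) K) = G.map (ι : GaloisField l 2 →+* K) := by
      rw [← hg, map_map, AlgHom.comp_algebraMap]
    rw [hmap, hG, Polynomial.map_mul, simplestCubic_map, map_mul, hroot, zero_mul]
  rw [← hfg, hg, hG]

/-- Cubic and sextic irreducible factors of `Ĥ_{7,l}(x)`: their root sets in an
algebraic closure of `𝔽_l` are invariant under `φ(d) = -1/(d-1)`; every monic
irreducible cubic factor has the form `g_a(x) = x³ + ax² - (a+3)x + 1` with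
`a ∈ 𝔽_l`; and every monic irreducible sextic factor factors over `𝔽_{l²}` as
`g_a(x)·g_{a^l}(x)` for some `a ∈ 𝔽_{l²}`. -/
theorem H7_cubic_sextic_factors (l : ℕ) [Fact l.Prime]
    (h2 : l ≠ 2) (h3 : l ≠ 3) (h7 : l ≠ 7)
    (f : Polynomial (ZMod l)) (hmonic : f.Monic) (hirr : Irreducible f)
    (hdvd : f ∣ H7 l) :
    (f.natDegree = 3 ∨ f.natDegree = 6 →
      ∀ d : AlgebraicClosure (ZMod l), aeval d f = 0 →
        d ≠ 1 ∧ aeval (-(d - 1)⁻¹) f = 0) ∧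
    (f.natDegree = 3 →
      ∃ a : ZMod l, f = X ^ 3 + C a * X ^ 2 - C (a + 3) * X + 1) ∧
    (f.natDegree = 6 →
      ∃ a : GaloisField l 2,
        f.map (algebraMap (ZMod l) (GaloisField l 2)) =
          (X ^ 3 + C a * X ^ 2 - C (a + 3) * X + 1) *
          (X ^ 3 + C (a ^ l) * X ^ 2 - C (a ^ l + 3) * X + 1)) := by
  have orbit : f.natDegree = 3 ∨ f.natDegree = 6 → ∀ d : AlgebraicClosure (ZMod l),
      aeval d f = 0 → d ≠ 1 ∧ aeval (-(d - 1)⁻¹) f = 0 ∧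
        aeval d (simplestCubic (-(d + d ^ l ^ 2 + d ^ l ^ 4))) = 0 := by
    intro hdeg d hd
    obtain ⟨-, hd1, h⟩ := pow_sq_of_aeval_H7_eq_zero l h2 h3 h7
      (aeval_eq_zero_of_dvd_aeval_eq_zero hdvd hd)
    have hne : d ^ l ^ 2 ≠ d := by
      rw [Ne, pow_prime_pow_eq_self_iff hirr hd]
      rcases hdeg with h | h <;> rw [h] <;> decide
    obtain ⟨hφ, hcubic⟩ := orbit_of_pow_sq hd1 (h.resolve_left hne)
    refine ⟨hd1, ?_, ?_⟩
    · rcases hφ with hφ | hφ <;> rw [← hφ] <;> exact aeval_pow_prime_pow_eq_zero hd _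
    · rw [← hcubic]
      simp [simplestCubic, map_ofNat C]
      ring
  obtain ⟨d, hd⟩ : ∃ d : AlgebraicClosure (ZMod l), aeval d f = 0 :=
    IsAlgClosed.exists_aeval_eq_zero _ f hirr.degree_pos.ne'
  refine ⟨fun hdeg d hd => ?_, fun hdeg => ?_, fun hdeg => ?_⟩
  · obtain ⟨hd1, hφ, -⟩ := orbit hdeg d hd
    exact ⟨hd1, hφ⟩
  · exact exists_simplestCubic_eq hmonic hirr hdeg hd rfl (orbit (.inl hdeg) d hd).2.2
  · exact exists_map_eq_simplestCubic_mul hmonic hirr hdeg hd rfl (orbit (.inr hdeg) d hd).2.2
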